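/- Let 𝔽 be an algebraically closed field of characteristic zero and let h ∈ R* be a vertex model. Then there exists h' ∈ R* such that f_h(G) = f_{h'}(G) for all graphs G ∈ 𝒢, and such that for every k ∈ ℕ the rank of the edge connection matrix M_{f_h,k} equals the dimension of the space (V^{⊗k})^{Stab(h')} of tensors fixed by every element of Stab(h'). -/

import Mathlib

/-!
Formalization framework for "Partition functions of vertex models /
edge connection matrices" (Regts–Draisma style).

Graphs and fragments are finite multigraphs (allowing multiple edges, loops
and circles); a `k`-fragment additionally has `k` labelled open ends.  We
encode a `k`-fragment by a number `nv` of internal vertices, a number `ne`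
of edges, and for each edge the multiset of its endpoints, each endpoint
being either an internal vertex (`Sum.inl`) or an open-end label
(`Sum.inr`).  Every edge has `2` endpoints (counted with multiplicity; a
loop at `v` lists `v` twice) or `0` endpoints (a circle), and every label
occurs exactly once in total (the open ends have degree one).
-/

open MvPolynomial

namespace VertexModels

noncomputable section

/-- A `k`-fragment. For `k = 0` this is a graph. -/
structure Fragment (k : ℕ) : Type where
  nv : ℕ
  ne : ℕ
  inc : Fin ne → Multiset (Fin nv ⊕ Fin k)
  card_inc : ∀ e, Multiset.card (inc e) = 2 ∨ Multiset.card (inc e) = 0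
  openEnd : ∀ j : Fin k, (∑ e, (inc e).count (Sum.inr j)) = 1

/-- A graph: a `0`-fragment. -/
abbrev Graph := Fragment 0

/-- The basic `k`-fragment `F_k`: one internal vertex joined to each of the
`k` open ends by a half edge. -/
def basicFragment (k : ℕ) : Fragment k where
  nv := 1
  ne := k
  inc := fun e => {Sum.inl 0, Sum.inr e}
  card_inc := fun e => Or.inl (by simp)
  openEnd := fun j => by
    have h : ∀ e : Fin k,
        Multiset.count (Sum.inr j) ({Sum.inl 0, Sum.inr e} : Multiset (Fin 1 ⊕ Fin k))
          = if j = e then 1 else 0 := by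
      intro e
      by_cases he : j = e <;>
        simp [Multiset.count_cons, Multiset.count_singleton, he]
    simp only [h]
    simp

variable {𝔽 : Type} [Field 𝔽] {n : ℕ}

/-- A vertex model: a linear functional on `R = 𝔽[x_1, …, x_n]`. -/
abbrev VertexModel (𝔽 : Type) [Field 𝔽] (n : ℕ) : Type :=
  MvPolynomial (Fin n) 𝔽 →ₗ[𝔽] 𝔽

/-- The monomial `∏_{e ∈ δ(v)} x_{ψ(e)}` seen by the internal vertex `v` of a
fragment under the edge colouring `ψ`. -/
def monomialAt {k : ℕ} (F : Fragment k) (ψ : Fin F.ne → Fin n) (v : Fin F.nv) :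
    MvPolynomial (Fin n) 𝔽 :=
  ∏ e, (X (ψ e) : MvPolynomial (Fin n) 𝔽) ^ ((F.inc e).count (Sum.inl v))

/-- The partition function `f_h` of the vertex model `h`. -/
def partitionFun (h : VertexModel 𝔽 n) (G : Graph) : 𝔽 :=
  ∑ ψ : Fin G.ne → Fin n, ∏ v, h (monomialAt G ψ v)

/-- `h_φ(F)`, for a `k`-fragment `F` and a colouring `φ` of the open ends. -/
def hphi (h : VertexModel 𝔽 n) {k : ℕ} (F : Fragment k) (φ : Fin k → Fin n) : 𝔽 :=
  ∑ ψ ∈ Finset.univ.filter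
      (fun ψ : Fin F.ne → Fin n => ∀ (e : Fin F.ne) (j : Fin k),
        Sum.inr j ∈ F.inc e → ψ e = φ j),
    ∏ v, h (monomialAt F ψ v)

/-- `V^{⊗ k}` in coordinates: functions on multi-indices, with basis
`e_φ`. -/
abbrev Tensor (𝔽 : Type) [Field 𝔽] (n k : ℕ) : Type := (Fin k → Fin n) → 𝔽

/-- The tensor `p_h(F) = ∑_φ h_φ(F) e_φ ∈ V^{⊗ k}`. -/
def ph (h : VertexModel 𝔽 n) {k : ℕ} (F : Fragment k) : Tensor 𝔽 n k :=
  fun φ => hphi h F φ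

/-- The standard bilinear form on `V^{⊗ k}`. -/
def tpair {k : ℕ} (t s : Tensor 𝔽 n k) : 𝔽 := ∑ φ, t φ * s φ

/-- Tensor product `V^{⊗ k} × V^{⊗ l} → V^{⊗ (k+l)}`. -/
def tmul {k l : ℕ} (t : Tensor 𝔽 n k) (s : Tensor 𝔽 n l) : Tensor 𝔽 n (k + l) :=
  fun φ => t (fun i => φ (Fin.castAdd l i)) * s (fun i => φ (Fin.natAdd k i))

/-- The contraction `C^k_{i,j} : V^{⊗ k} → V^{⊗ (k-2)}` (here `k = m + 2`),
contracting the `i`-th and `j`-th tensor factors (`i < j`). -/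
def tcontract {m : ℕ} (i j : Fin (m + 2)) (t : Tensor 𝔽 n (m + 2)) : Tensor 𝔽 n m :=
  fun φ => ∑ c : Fin n,
    t (Fin.insertNth i c (Fin.insertNth (⟨j.1 - 1, by have := j.isLt; omega⟩ : Fin (m + 1)) c φ))

/-- The orthogonal group `O_n`, as the set of matrices `g` with `gᵀ g = 1`. -/
def orthSet (𝔽 : Type) [Field 𝔽] (n : ℕ) : Set (Matrix (Fin n) (Fin n) 𝔽) :=
  {g | g.transpose * g = 1}

/-- Substitution `X i ↦ ∑ j, g i j • X j`, i.e. composition of a polynomial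
with the linear map `g`, as a linear endomorphism of `R`. -/
noncomputable def polSub (g : Matrix (Fin n) (Fin n) 𝔽) :
    MvPolynomial (Fin n) 𝔽 →ₗ[𝔽] MvPolynomial (Fin n) 𝔽 :=
  (MvPolynomial.aeval (fun i => ∑ j, MvPolynomial.C (g i j) * X j)).toLinearMap

/-- The action of `g ∈ O_n` on vertex models: `(g h)(p) = h (p ∘ g) = h(g⁻¹ • p)`. -/
noncomputable def dualAct (g : Matrix (Fin n) (Fin n) 𝔽) (h : VertexModel 𝔽 n) :
    VertexModel 𝔽 n :=
  h.comp (polSub g)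

/-- The stabilizer `Stab(h) = {g ∈ O_n ∣ g h = h}`. -/
noncomputable def Stab (h : VertexModel 𝔽 n) : Set (Matrix (Fin n) (Fin n) 𝔽) :=
  {g | g ∈ orthSet 𝔽 n ∧ dualAct g h = h}

/-- The diagonal action of a matrix `g` on `V^{⊗ k}`. -/
def tact (g : Matrix (Fin n) (Fin n) 𝔽) (k : ℕ) :
    Tensor 𝔽 n k →ₗ[𝔽] Tensor 𝔽 n k :=
  Matrix.mulVecLin (Matrix.of fun φ ψ : Fin k → Fin n => ∏ i, g (φ i) (ψ i))

/-- The subspace `(V^{⊗ k})^S` of tensors fixed by every element of a set `S`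
of matrices. -/
def invSub (S : Set (Matrix (Fin n) (Fin n) 𝔽)) (k : ℕ) :
    Submodule 𝔽 (Tensor 𝔽 n k) where
  carrier := {t | ∀ g ∈ S, tact g k t = t}
  add_mem' := fun {a b} ha hb => by
    intro g hg
    rw [map_add, ha g hg, hb g hg]
  zero_mem' := by
    intro g hg
    rw [map_zero]
  smul_mem' := fun c a ha => by
    intro g hg
    rw [map_smul, ha g hg]

/-! ### Gluing two `k`-fragments into a graph -/

/-- `touches F H j a`: the edge `a` of the disjoint union of `F` and `H` is
incident with the open end labelled `j` (of its own fragment). -/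
def touches {k : ℕ} (F H : Fragment k) (j : Fin k) : Fin F.ne ⊕ Fin H.ne → Prop
  | .inl e => Sum.inr j ∈ F.inc e
  | .inr e => Sum.inr j ∈ H.inc e

/-- Edges of `F` and `H` which get merged into a single edge of `F * H` are
identified by the equivalence generated by sharing an open-end label. -/
def glueSetoid {k : ℕ} (F H : Fragment k) : Setoid (Fin F.ne ⊕ Fin H.ne) :=
  Relation.EqvGen.setoid (fun a b => ∃ j, touches F H j a ∧ touches F H j b)

/-- Number of edges of the glued graph `F * H`. -/
noncomputable def glueNE {k : ℕ} (F H : Fragment k) : ℕ :=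
  Nat.card (Quotient (glueSetoid F H))

noncomputable def glueEquiv {k : ℕ} (F H : Fragment k) :
    Fin (glueNE F H) ≃ Quotient (glueSetoid F H) :=
  (Finite.equivFin _).symm

/-- The internal (non-open-end) endpoints of an edge of the disjoint union,
re-indexed in `Fin (F.nv + H.nv)`. -/
def intEnds {k : ℕ} (F H : Fragment k) :
    Fin F.ne ⊕ Fin H.ne → Multiset (Fin (F.nv + H.nv) ⊕ Fin 0)
  | .inl e => (F.inc e).filterMap fun x =>
      match x with
      | .inl v => some (Sum.inl (Fin.castAdd H.nv v))
      | .inr _ => none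
  | .inr e => (H.inc e).filterMap fun x =>
      match x with
      | .inl v => some (Sum.inl (Fin.natAdd F.nv v))
      | .inr _ => none

/-- Endpoints of an edge of the glued graph: the internal endpoints of all
edges merged into it. -/
noncomputable def glueInc {k : ℕ} (F H : Fragment k) (c : Fin (glueNE F H)) :
    Multiset (Fin (F.nv + H.nv) ⊕ Fin 0) := by
  classical
  exact ∑ a ∈ Finset.univ.filter
    (fun a => Quotient.mk (glueSetoid F H) a = glueEquiv F H c), intEnds F H a

/-- The glued graph `F * H` of two `k`-fragments: connect the half edges
with equally labelled open ends into single edges (chains of half edges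
closing up produce circles).  (The impossible degenerate branch is never
taken.) -/
noncomputable def glue {k : ℕ} (F H : Fragment k) : Graph := by
  classical
  exact if hc : ∀ c, Multiset.card (glueInc F H c) = 2 ∨ Multiset.card (glueInc F H c) = 0 then
    { nv := F.nv + H.nv
      ne := glueNE F H
      inc := glueInc F H
      card_inc := hc
      openEnd := fun j => j.elim0 }
  else basicFragment 0

/-- The rank of the edge connection matrix `M_{f_h,k}` : the dimension of the
span of its rows. -/
noncomputable def connectionRank (h : VertexModel 𝔽 n) (k : ℕ) : ℕ :=
  Module.finrank 𝔽 (Submodule.span 𝔽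
    (Set.range fun F : Fragment k => fun H : Fragment k => partitionFun h (glue F H)))

/-! ### The algebra `𝒜` of formal linear combinations of fragments -/

/-- `p_h` on formal linear combinations `𝔽ℱ_k` of `k`-fragments. -/
noncomputable def phL (h : VertexModel 𝔽 n) (k : ℕ) :
    (Fragment k →₀ 𝔽) →ₗ[𝔽] Tensor 𝔽 n k :=
  Finsupp.linearCombination 𝔽 (fun F : Fragment k => ph h F)

/-- `γ ↦ (F ↦ f_h(γ * F))`: the bilinear extension of gluing followed by the
partition function.  Its kernel is `I_k`. -/
noncomputable def glueRow (h : VertexModel 𝔽 n) (k : ℕ) :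
    (Fragment k →₀ 𝔽) →ₗ[𝔽] (Fragment k → 𝔽) :=
  Finsupp.linearCombination 𝔽
    (fun F : Fragment k => fun H : Fragment k => partitionFun h (glue F H))

/-- A vertex model is nondegenerate if `ker p_h = I`. -/
def Nondeg (h : VertexModel 𝔽 n) : Prop :=
  ∀ (k : ℕ) (γ : Fragment k →₀ 𝔽), phL h k γ = 0 ↔ glueRow h k γ = 0

/-! ### The product of fragments and the contraction of fragments -/

/-- Endpoint multisets of the disjoint union `F H` of fragments (`H`'s open
ends relabelled by `i ↦ k + i`). -/
def mulInc {k l : ℕ} (F : Fragment k) (H : Fragment l) :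
    Fin (F.ne + H.ne) → Multiset (Fin (F.nv + H.nv) ⊕ Fin (k + l)) :=
  Fin.addCases
    (fun e => (F.inc e).map (Sum.map (Fin.castAdd H.nv) (Fin.castAdd l)))
    (fun e => (H.inc e).map (Sum.map (Fin.natAdd F.nv) (Fin.natAdd k)))

/-- The product `F H` in the fragment algebra `𝒜`: disjoint union, with the
open ends of `H` relabelled `i ↦ k + i`.  (The impossible degenerate branch
is never taken.) -/
noncomputable def fragMul {k l : ℕ} (F : Fragment k) (H : Fragment l) :
    Fragment (k + l) := by
  classical
  exact if hc : (∀ e, Multiset.card (mulInc F H e) = 2 ∨ Multiset.card (mulInc F H e) = 0)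
      ∧ (∀ j : Fin (k + l), (∑ e, (mulInc F H e).count (Sum.inr j)) = 1) then
    { nv := F.nv + H.nv
      ne := F.ne + H.ne
      inc := mulInc F H
      card_inc := hc.1
      openEnd := hc.2 }
  else basicFragment (k + l)

/-- Relabelling map for labels after removing labels `i` and `j` (`i < j`),
preserving the order of the remaining labels. -/
def downLabel {m : ℕ} (i j l : Fin (m + 2)) (hij : i < j) (h : ¬(l = i ∨ l = j)) : Fin m :=
  ⟨l.1 - (if i.1 < l.1 then 1 else 0) - (if j.1 < l.1 then 1 else 0), by
    push_neg at h
    have h1 : l.1 ≠ i.1 := fun hh => h.1 (Fin.ext hh)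
    have h2 : l.1 ≠ j.1 := fun hh => h.2 (Fin.ext hh)
    have h3 : i.1 < j.1 := hij
    have h4 := l.isLt
    have h6 := j.isLt
    split_ifs <;> omega⟩

/-- Removing the open ends `i` and `j` from an endpoint multiset and
relabelling the remaining open ends. -/
def removeEnd {m nv : ℕ} (i j : Fin (m + 2)) (hij : i < j) :
    Fin nv ⊕ Fin (m + 2) → Option (Fin nv ⊕ Fin m)
  | .inl v => some (.inl v)
  | .inr l => if h : l = i ∨ l = j then none else some (.inr (downLabel i j l hij h))

/-- Edges merged by the contraction `Γ^k_{i,j}`: those incident with the open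
end `i` or the open end `j`. -/
def contractSetoid {m : ℕ} (F : Fragment (m + 2)) (i j : Fin (m + 2)) :
    Setoid (Fin F.ne) :=
  Relation.EqvGen.setoid (fun e e' =>
    (Sum.inr i ∈ F.inc e ∨ Sum.inr j ∈ F.inc e) ∧
    (Sum.inr i ∈ F.inc e' ∨ Sum.inr j ∈ F.inc e'))

noncomputable def contractNE {m : ℕ} (F : Fragment (m + 2)) (i j : Fin (m + 2)) : ℕ :=
  Nat.card (Quotient (contractSetoid F i j))

noncomputable def contractEquiv {m : ℕ} (F : Fragment (m + 2)) (i j : Fin (m + 2)) :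
    Fin (contractNE F i j) ≃ Quotient (contractSetoid F i j) :=
  (Finite.equivFin _).symm

noncomputable def contractInc {m : ℕ} (F : Fragment (m + 2)) (i j : Fin (m + 2))
    (hij : i < j) (c : Fin (contractNE F i j)) : Multiset (Fin F.nv ⊕ Fin m) := by
  classical
  exact ∑ e ∈ Finset.univ.filter
    (fun e => Quotient.mk (contractSetoid F i j) e = contractEquiv F i j c),
    (F.inc e).filterMap (removeEnd i j hij)

/-- The contraction `Γ^k_{i,j}(F)` of a `(m+2)`-fragment: join the half edges
at the open ends labelled `i` and `j` into a single edge (possibly a circle)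
and relabel the remaining open ends preserving their order.  (The impossible
degenerate branch is never taken.) -/
noncomputable def fragContract {m : ℕ} (i j : Fin (m + 2)) (hij : i < j)
    (F : Fragment (m + 2)) : Fragment m := by
  classical
  exact if hc : (∀ c, Multiset.card (contractInc F i j hij c) = 2 ∨
        Multiset.card (contractInc F i j hij c) = 0)
      ∧ (∀ jj : Fin m, (∑ c, (contractInc F i j hij c).count (Sum.inr jj)) = 1) then
    { nv := F.nv
      ne := contractNE F i j
      inc := contractInc F i j hij
      card_inc := hc.1
      openEnd := hc.2 }
  else basicFragment m

/-! ### Zariski closedness, spin models, reductivity -/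

/-- A subset of a coordinate space `ι → 𝔽` is Zariski closed if it is the
common zero locus of a set of polynomials. -/
def IsZarClosed {ι : Type} (S : Set (ι → 𝔽)) : Prop :=
  ∃ P : Set (MvPolynomial ι 𝔽), S = {x | ∀ p ∈ P, MvPolynomial.eval x p = 0}

/-- The vertex model `h(p) = ∑ i, a i • p (u i)` attached to points
`u_1, …, u_m` and coefficients `a_1, …, a_m`. -/
noncomputable def spinModel {m : ℕ} (u : Fin m → (Fin n → 𝔽)) (a : Fin m → 𝔽) :
    VertexModel 𝔽 n :=
  ∑ i, a i • (MvPolynomial.aeval (u i) : MvPolynomial (Fin n) 𝔽 →ₐ[𝔽] 𝔽).toLinearMap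

/-- Multi-degrees of total degree at most `e`: coordinates for the space
`(R_{≤ e})^*`. -/
def LowDeg (n e : ℕ) : Type := {d : Fin n →₀ ℕ // (d.sum fun _ c => c) ≤ e}

/-- The `O_n`-orbit of `h_e` (the restriction of `h` to polynomials of degree
at most `e`), in coordinates. -/
noncomputable def restOrbit (h : VertexModel 𝔽 n) (e : ℕ) : Set (LowDeg n e → 𝔽) :=
  {y | ∃ g ∈ orthSet 𝔽 n, ∀ d : LowDeg n e,
    y d = dualAct g h (MvPolynomial.monomial d.1 (1 : 𝔽))}

/-- The `O_n`-orbit of an `m`-tuple of vectors, in coordinates. -/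
def vecOrbit {m : ℕ} (u : Fin m → (Fin n → 𝔽)) : Set (Fin m × Fin n → 𝔽) :=
  {y | ∃ g ∈ orthSet 𝔽 n, ∀ p : Fin m × Fin n, y p = g.mulVec (u p.1) p.2}

/-- The `O_n`-orbit of an element `w` of `⊕_{k ≤ e} V^{⊗ k}`, in
coordinates. -/
def tensorTupleOrbit (e : ℕ) (w : ∀ k : ℕ, Tensor 𝔽 n k) :
    Set ((Σ p : Fin (e + 1), (Fin p.1 → Fin n)) → 𝔽) :=
  {y | ∃ g ∈ orthSet 𝔽 n, ∀ q : Σ p : Fin (e + 1), (Fin p.1 → Fin n),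
    y q = tact g q.1 (w q.1) q.2}

/-- Linear reductivity of a set `H` of `n × n` matrices: in every
polynomial representation of `H`, every `H`-invariant subspace admits an
`H`-invariant complement. -/
def IsLinRed (H : Set (Matrix (Fin n) (Fin n) 𝔽)) : Prop :=
  ∀ (m : ℕ) (ρ : Matrix (Fin n) (Fin n) 𝔽 → Matrix (Fin m) (Fin m) 𝔽),
    (∀ a b : Fin m, ∃ p : MvPolynomial (Fin n × Fin n) 𝔽,
      ∀ g, ρ g a b = MvPolynomial.eval (fun q => g q.1 q.2) p) →
    (∀ g ∈ H, ∀ g' ∈ H, ρ (g * g') = ρ g * ρ g') → ρ 1 = 1 →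
    ∀ W : Submodule 𝔽 (Fin m → 𝔽),
      (∀ g ∈ H, ∀ w ∈ W, (ρ g).mulVec w ∈ W) →
      ∃ W' : Submodule 𝔽 (Fin m → 𝔽), IsCompl W W' ∧
        (∀ g ∈ H, ∀ w ∈ W', (ρ g).mulVec w ∈ W')

/-- The pointwise stabilizer in `O_n` of a graded family of subspaces of the
tensor algebra. -/
def setStab (A : ∀ k : ℕ, Submodule 𝔽 (Tensor 𝔽 n k)) :
    Set (Matrix (Fin n) (Fin n) 𝔽) :=
  {g | g ∈ orthSet 𝔽 n ∧ ∀ (k : ℕ), ∀ a ∈ A k, tact g k a = a}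

/-- The sum of the nontrivial `H`-isotypic components of `V^{⊗ k}`: the
largest `H`-stable subspace meeting the invariants trivially. -/
def nontrivialPart (H : Set (Matrix (Fin n) (Fin n) 𝔽)) (k : ℕ) :
    Submodule 𝔽 (Tensor 𝔽 n k) :=
  sSup {W | (∀ g ∈ H, ∀ w ∈ W, tact g k w ∈ W) ∧ W ⊓ invSub H k = ⊥}

end

end VertexModels

open VertexModels

namespace VertexModels

section Gluing

/-- The setoid obtained from `r` by merging the classes of `a` and `b`. -/
def mergeSetoid {E : Type} (r : Setoid E) (a b : E) : Setoid E where
  r x y := r x y ∨ (r x a ∧ r b y) ∨ (r x b ∧ r a y)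
  iseqv := by
    refine ⟨fun x => Or.inl (r.refl x), ?_, ?_⟩
    · rintro x y (h | ⟨h1, h2⟩ | ⟨h1, h2⟩)
      · exact Or.inl (r.symm h)
      · exact Or.inr (Or.inr ⟨r.symm h2, r.symm h1⟩)
      · exact Or.inr (Or.inl ⟨r.symm h2, r.symm h1⟩)
    · rintro x y z (h | ⟨h1, h2⟩ | ⟨h1, h2⟩) (k | ⟨k1, k2⟩ | ⟨k1, k2⟩)
      · exact Or.inl (r.trans h k)
      · exact Or.inr (Or.inl ⟨r.trans h k1, k2⟩)
      · exact Or.inr (Or.inr ⟨r.trans h k1, k2⟩)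
      · exact Or.inr (Or.inl ⟨h1, r.trans h2 k⟩)
      · exact Or.inr (Or.inl ⟨h1, k2⟩)
      · exact Or.inl (r.trans h1 k2)
      · exact Or.inr (Or.inr ⟨h1, r.trans h2 k⟩)
      · exact Or.inl (r.trans h1 k2)
      · exact Or.inr (Or.inr ⟨h1, k2⟩)

open Classical in
lemma mergeSetoid_classSum {E : Type} [Fintype E] (r : Setoid E) (a b : E) (u : E → ℕ)
    (h : ∀ e₀, (∑ e with r e e₀,
      (u e + (if a = e then 1 else 0) + (if b = e then 1 else 0))) = 2 ∨
      (∑ e with r e e₀, (u e + (if a = e then 1 else 0) + (if b = e then 1 else 0))) = 0)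
    (e₀ : E) :
    (∑ e with mergeSetoid r a b e e₀, u e) = 2 ∨ (∑ e with mergeSetoid r a b e e₀, u e) = 0 := by
  have hs : ∀ e₀, (∑ e with r e e₀,
      (u e + (if a = e then 1 else 0) + (if b = e then 1 else 0))) =
      (∑ e with r e e₀, u e) + (if r a e₀ then 1 else 0) + (if r b e₀ then 1 else 0) := by
    intro e₀
    simp [Finset.sum_add_distrib, Finset.sum_ite_eq]
  simp only [hs] at h
  have key : ∀ x, mergeSetoid r a b x e₀ ↔
      (r x e₀ ∨ (r x a ∧ r b e₀) ∨ (r x b ∧ r a e₀)) := fun x => Iff.rfl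
  by_cases hab : r a b
  · have : ∀ x, mergeSetoid r a b x e₀ ↔ r x e₀ := by
      intro x
      rw [key]
      constructor
      · rintro (h | ⟨h1, h2⟩ | ⟨h1, h2⟩)
        · exact h
        · exact r.trans h1 (r.trans hab h2)
        · exact r.trans h1 (r.trans (r.symm hab) h2)
      · exact Or.inl
    simp only [this]
    have hiff : r a e₀ ↔ r b e₀ :=
      ⟨fun h => r.trans (r.symm hab) h, fun h => r.trans hab h⟩
    have := h e₀
    by_cases h1 : r a e₀
    · simp only [h1, hiff.1 h1, if_true] at this
      omega
    · have h2 : ¬ r b e₀ := fun h => h1 (hiff.2 h)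
      simpa only [h1, h2, if_false, add_zero] using this
  · have hba : ¬ r b a := fun h => hab (r.symm h)
    have ha := h a
    have hb := h b
    simp only [r.refl a, r.refl b, hab, hba, if_true, if_false] at ha hb
    have hsum : (∑ e with (r e a ∨ r e b), u e) =
        (∑ e with r e a, u e) + (∑ e with r e b, u e) := by
      rw [Finset.filter_or, Finset.sum_union]
      rw [Finset.disjoint_filter]
      intro x _ h1 h2
      exact hab (r.trans (r.symm h1) h2)
    by_cases h1 : r a e₀
    · have : ∀ x, mergeSetoid r a b x e₀ ↔ (r x a ∨ r x b) := by
        intro x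
        rw [key]
        constructor
        · rintro (h | ⟨h2, h3⟩ | ⟨h2, h3⟩)
          · exact Or.inl (r.trans h (r.symm h1))
          · exact Or.inl h2
          · exact Or.inr h2
        · rintro (h | h)
          · exact Or.inl (r.trans h h1)
          · exact Or.inr (Or.inr ⟨h, h1⟩)
      simp only [this, hsum]
      omega
    · by_cases h2 : r b e₀
      · have : ∀ x, mergeSetoid r a b x e₀ ↔ (r x a ∨ r x b) := by
          intro x
          rw [key]
          constructor
          · rintro (h | ⟨h2', h3⟩ | ⟨h2', h3⟩)
            · exact Or.inr (r.trans h (r.symm h2))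
            · exact Or.inl h2'
            · exact Or.inr h2'
          · rintro (h | h)
            · exact Or.inr (Or.inl ⟨h, h2⟩)
            · exact Or.inl (r.trans h h2)
        simp only [this, hsum]
        omega
      · have : ∀ x, mergeSetoid r a b x e₀ ↔ r x e₀ := by
          intro x
          rw [key]
          simp [h1, h2]
        simp only [this]
        have := h e₀
        simpa only [h1, h2, if_false, add_zero] using this

open Classical in
lemma exists_glueSetoid_classSum {E L : Type} [Fintype E] (a b : L → E) (s : Finset L) :
    ∃ r : Setoid E, (∀ l ∈ s, r (a l) (b l)) ∧
      (∀ r' : Setoid E, (∀ l ∈ s, r' (a l) (b l)) → r ≤ r') ∧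
      ∀ u : E → ℕ,
        (∀ e, u e + (∑ l ∈ s, if a l = e then 1 else 0) + (∑ l ∈ s, if b l = e then 1 else 0) = 2 ∨
          u e + (∑ l ∈ s, if a l = e then 1 else 0) + (∑ l ∈ s, if b l = e then 1 else 0) = 0) →
        ∀ e₀, (∑ e with r e e₀, u e) = 2 ∨ (∑ e with r e e₀, u e) = 0 := by
  induction s using Finset.induction_on with
  | empty =>
    refine ⟨⊥, by simp, fun _ _ => bot_le, fun u hu e₀ => ?_⟩
    have : (∑ e with (⊥ : Setoid E) e e₀, u e) = u e₀ := by
      have : ∀ e, (⊥ : Setoid E) e e₀ ↔ e = e₀ := fun e => Iff.rfl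
      rw [Finset.sum_filter]
      simp only [this]
      simp
    rw [this]
    simpa using hu e₀
  | insert j s hj ih =>
    obtain ⟨r, h1, h2, h3⟩ := ih
    refine ⟨mergeSetoid r (a j) (b j), ?_, ?_, ?_⟩
    · intro l hl
      rcases Finset.mem_insert.1 hl with rfl | hl
      · exact Or.inr (Or.inl ⟨r.refl _, r.refl _⟩)
      · exact Or.inl (h1 l hl)
    · intro r' hr'
      have hle := h2 r' (fun l hl => hr' l (Finset.mem_insert_of_mem hl))
      have hj' := hr' j (Finset.mem_insert_self _ _)
      rintro x y (h | ⟨h, h'⟩ | ⟨h, h'⟩)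
      · exact hle h
      · exact r'.trans (hle h) (r'.trans hj' (hle h'))
      · exact r'.trans (hle h) (r'.trans (r'.symm hj') (hle h'))
    · intro u hu
      refine mergeSetoid_classSum r (a j) (b j) u (h3 _ ?_)
      intro e
      have := hu e
      rw [Finset.sum_insert hj, Finset.sum_insert hj] at this
      omega

open Classical in
/-- If a matching structure with multiplicities `u` and pairs `(a l, b l)` of
ends is glued along all pairs, every class has two or no remaining ends. -/
lemma classSum_of_least {E L : Type} [Fintype E] [Fintype L] (a b : L → E) (r : Setoid E)
    (hr : ∀ l, r (a l) (b l))
    (hle : ∀ r' : Setoid E, (∀ l, r' (a l) (b l)) → r ≤ r') (u : E → ℕ)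
    (hu : ∀ e, u e + (∑ l, if a l = e then 1 else 0) + (∑ l, if b l = e then 1 else 0) = 2 ∨
          u e + (∑ l, if a l = e then 1 else 0) + (∑ l, if b l = e then 1 else 0) = 0) (e₀ : E) :
    (∑ e with r e e₀, u e) = 2 ∨ (∑ e with r e e₀, u e) = 0 := by
  obtain ⟨r₁, h1, h2, h3⟩ := exists_glueSetoid_classSum a b Finset.univ
  have : r = r₁ := le_antisymm (hle _ fun l => h1 l (Finset.mem_univ _)) (h2 _ fun l _ => hr l)
  subst this
  exact h3 u hu e₀

open Classical in
/-- Colourings of a quotient are the colourings compatible with the generating pairs. -/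
lemma sum_quotient_coloring {E L C M : Type} [Fintype E] [Fintype C] [AddCommMonoid M]
    (a b : L → E) (r : Setoid E) [Fintype (Quotient r)]
    (hr : ∀ l, r (a l) (b l))
    (hle : ∀ r' : Setoid E, (∀ l, r' (a l) (b l)) → r ≤ r') (Φ : (E → C) → M) :
    ∑ ψ : Quotient r → C, Φ (fun e => ψ (Quotient.mk r e)) =
      ∑ ψ : E → C, if (∀ l, ψ (a l) = ψ (b l)) then Φ ψ else 0 := by
  rw [← Finset.sum_filter]
  refine Finset.sum_bij (fun ψ _ e => ψ (Quotient.mk r e)) ?_ ?_ ?_ ?_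
  · intro ψ _
    simp only [Finset.mem_filter, Finset.mem_univ, true_and]
    intro l
    rw [Quotient.sound (hr l)]
  · intro ψ _ ψ' _ h
    funext c
    induction c using Quotient.inductionOn with
    | h e => exact congrFun h e
  · intro ψ hψ
    simp only [Finset.mem_filter, Finset.mem_univ, true_and] at hψ
    refine ⟨Quotient.lift ψ (fun x y hxy => hle (Setoid.ker ψ) hψ hxy), Finset.mem_univ _, ?_⟩
    funext e
    rfl
  · intro ψ _
    rfl

end Gluing

section Diagrams

/-- Tensors over `R` whose factors are indexed by `ι`, in coordinates. -/
abbrev Ten (n : ℕ) (R ι : Type) : Type := (ι → Fin n) → R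

/-- Every fibre of `q` has two elements or none. -/
def Paired {X E : Type} [Fintype X] [DecidableEq E] (q : X → E) : Prop :=
  ∀ e, (∑ x, if q x = e then 1 else 0) = 2 ∨ (∑ x, if q x = e then 1 else 0) = 0

/-- The multiset of colours of the half edges at the vertex `v`. -/
def colorsAt {H V C : Type} [Fintype H] [DecidableEq V] (p : H → V) (c : H → C) (v : V) :
    Multiset C :=
  ∑ x, if p x = v then {c x} else 0

variable {n : ℕ} {R R' : Type} [CommRing R] [CommRing R']
set_option linter.unusedSectionVars false

variable {ι κ μ : Type} [Fintype ι] [Fintype κ] [Fintype μ]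
  [DecidableEq ι] [DecidableEq κ] [DecidableEq μ]

/-- The tensor of a diagram with vertices `V`, half edges `H`, edges `E` and open ends `ι`,
for the vertex model with values `m` on monomials. -/
def diagram {V H E : Type} [Fintype V] [Fintype H] [Fintype E] [DecidableEq V] [DecidableEq E]
    (m : Multiset (Fin n) → R) (p : H → V) (q : H ⊕ ι → E) : Ten n R ι := fun φ =>
  ∑ ψ : E → Fin n, if (∀ i, ψ (q (Sum.inr i)) = φ i) then
    ∏ v, m (colorsAt p (fun x => ψ (q (Sum.inl x))) v) else 0

/-- The tensors of diagrams all of whose vertex degrees lie in `D`. -/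
def Gen (m : Multiset (Fin n) → R) (D : Set ℕ) (ι : Type) [Fintype ι] : Set (Ten n R ι) :=
  {x | ∃ (V H E : Type) (_ : Fintype V) (_ : Fintype H) (_ : Fintype E) (_ : DecidableEq V)
    (_ : DecidableEq E) (p : H → V) (q : H ⊕ ι → E),
    Paired q ∧ (∀ v, (∑ x, if p x = v then 1 else 0) ∈ D) ∧ x = diagram m p q}

/-- Relabelling of tensor factors. -/
def relabel (e : ι ≃ κ) (x : Ten n R ι) : Ten n R κ := fun φ => x (φ ∘ e)

/-- Tensor product. -/
def prodT (x : Ten n R ι) (y : Ten n R κ) : Ten n R (ι ⊕ κ) :=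
  fun φ => x (φ ∘ Sum.inl) * y (φ ∘ Sum.inr)

/-- Contraction of the factors in `κ`. -/
def contractT (x : Ten n R (ι ⊕ κ)) (y : Ten n R κ) : Ten n R ι :=
  fun φ => ∑ ψ, x (Sum.elim φ ψ) * y ψ

/-- The trace over two copies of `κ`. -/
def traceT (x : Ten n R (ι ⊕ (κ ⊕ κ))) : Ten n R ι :=
  fun φ => ∑ ψ, x (Sum.elim φ (Sum.elim ψ ψ))

/-- The standard bilinear form. -/
def pairT (x y : Ten n R ι) : R := ∑ φ, x φ * y φ

/-- The tensor of the identity map. -/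
def idT (n : ℕ) (R ι : Type) [CommRing R] [DecidableEq ι] [Fintype ι] : Ten n R (ι ⊕ ι) :=
  fun φ => if φ ∘ Sum.inl = φ ∘ Sum.inr then 1 else 0

lemma Gen_mono (m : Multiset (Fin n) → R) {D D' : Set ℕ} (h : D ⊆ D') : Gen m D ι ⊆ Gen m D' ι := by
  rintro x ⟨V, H, E, _, _, _, _, _, p, q, hq, hp, rfl⟩
  exact ⟨V, H, E, inferInstance, inferInstance, inferInstance, inferInstance, inferInstance, p, q, hq, fun v => h (hp v), rfl⟩

lemma Gen_map (f : R →+* R') (m : Multiset (Fin n) → R) {D : Set ℕ} {x : Ten n R ι}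
    (hx : x ∈ Gen m D ι) : (fun φ => f (x φ)) ∈ Gen (fun d => f (m d)) D ι := by
  obtain ⟨V, H, E, _, _, _, _, _, p, q, hq, hp, rfl⟩ := hx
  refine ⟨V, H, E, inferInstance, inferInstance, inferInstance, inferInstance, inferInstance, p, q, hq, hp, ?_⟩
  funext φ
  simp only [diagram, map_sum, apply_ite f, map_prod, map_zero]

lemma exists_Gen_of_map (f : R →+* R') (m : Multiset (Fin n) → R) {D : Set ℕ} {x : Ten n R' ι}
    (hx : x ∈ Gen (fun d => f (m d)) D ι) : ∃ y ∈ Gen m D ι, (fun φ => f (y φ)) = x := by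
  obtain ⟨V, H, E, _, _, _, _, _, p, q, hq, hp, rfl⟩ := hx
  refine ⟨_, ⟨V, H, E, inferInstance, inferInstance, inferInstance, inferInstance, inferInstance, p, q, hq, hp, rfl⟩, ?_⟩
  funext φ
  simp only [diagram, map_sum, apply_ite f, map_prod, map_zero]

lemma Gen_relabel (m : Multiset (Fin n) → R) {D : Set ℕ} (e : ι ≃ κ) {x : Ten n R ι}
    (hx : x ∈ Gen m D ι) : relabel e x ∈ Gen m D κ := by
  obtain ⟨V, H, E, _, _, _, _, _, p, q, hq, hp, rfl⟩ := hx
  refine ⟨V, H, E, inferInstance, inferInstance, inferInstance, inferInstance, inferInstance, p, fun y => q (Sum.map id e.symm y), ?_, hp, ?_⟩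
  · intro c
    have := hq c
    rw [← Equiv.sum_comp (Equiv.sumCongr (Equiv.refl H) e.symm)] at this
    exact this
  · funext φ
    simp only [relabel, diagram, Sum.map_inl, Sum.map_inr, id]
    refine Finset.sum_congr rfl fun ψ _ => ?_
    congr 1
    rw [eq_iff_iff]
    constructor
    · intro h i
      rw [h]
      simp
    · intro h i
      have := h (e i)
      simpa using this

lemma Gen_prodT (m : Multiset (Fin n) → R) {D : Set ℕ} {x : Ten n R ι} {y : Ten n R κ}
    (hx : x ∈ Gen m D ι) (hy : y ∈ Gen m D κ) : prodT x y ∈ Gen m D (ι ⊕ κ) := by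
  obtain ⟨V, H, E, _, _, _, _, _, p, q, hq, hp, rfl⟩ := hx
  obtain ⟨V', H', E', _, _, _, _, _, p', q', hq', hp', rfl⟩ := hy
  refine ⟨V ⊕ V', H ⊕ H', E ⊕ E', inferInstance, inferInstance, inferInstance, inferInstance,
    inferInstance, Sum.map p p',
    Sum.elim (Sum.map (q ∘ Sum.inl) (q' ∘ Sum.inl)) (Sum.map (q ∘ Sum.inr) (q' ∘ Sum.inr)),
    ?_, ?_, ?_⟩
  · rintro (c | c)
    · simpa [Fintype.sum_sum_type, -Finset.sum_boole] using hq c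
    · simpa [Fintype.sum_sum_type, -Finset.sum_boole] using hq' c
  · rintro (v | v)
    · simpa [Fintype.sum_sum_type, -Finset.sum_boole] using hp v
    · simpa [Fintype.sum_sum_type, -Finset.sum_boole] using hp' v
  · funext φ
    simp only [prodT, diagram]
    rw [← Equiv.sum_comp (Equiv.sumArrowEquivProdArrow E E' (Fin n)).symm, Fintype.sum_prod_type,
      Finset.sum_mul_sum]
    refine Finset.sum_congr rfl fun α _ => Finset.sum_congr rfl fun β _ => ?_
    simp [Sum.forall, Fintype.prod_sum_type, colorsAt, Fintype.sum_sum_type, ite_and]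
    split_ifs <;> simp

open Classical in
lemma Gen_traceT (m : Multiset (Fin n) → R) {D : Set ℕ} {x : Ten n R (ι ⊕ (κ ⊕ κ))}
    (hx : x ∈ Gen m D (ι ⊕ (κ ⊕ κ))) : traceT x ∈ Gen m D ι := by
  obtain ⟨V, H, E, _, _, _, _, dE, p, q, hq, hp, rfl⟩ := hx
  obtain rfl : dE = fun a b => Classical.propDecidable (a = b) := Subsingleton.elim _ _
  let a : κ → E := fun k => q (Sum.inr (Sum.inr (Sum.inl k)))
  let b : κ → E := fun k => q (Sum.inr (Sum.inr (Sum.inr k)))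
  let q' : H ⊕ ι → E := fun y => q (Sum.map id Sum.inl y)
  obtain ⟨r, hr, hle, -⟩ := exists_glueSetoid_classSum a b Finset.univ
  simp only [Finset.mem_univ, true_imp_iff] at hr hle
  refine ⟨V, H, Quotient r, inferInstance, inferInstance, inferInstance, inferInstance,
    inferInstance, p, fun y => Quotient.mk r (q' y), ?_, hp, ?_⟩
  · intro c
    induction c using Quotient.inductionOn with
    | h e₀ =>
    have := classSum_of_least a b r hr hle (fun e => ∑ y, if q' y = e then 1 else 0) (by
      intro e
      have := hq e
      rw [Fintype.sum_sum_type, Fintype.sum_sum_type, Fintype.sum_sum_type, ← add_assoc,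
        ← add_assoc] at this
      rw [Fintype.sum_sum_type]
      exact this) e₀
    rw [Finset.sum_comm] at this
    have h2 : ∀ y, (∑ e with r e e₀, if q' y = e then 1 else 0) =
        if Quotient.mk r (q' y) = Quotient.mk r e₀ then 1 else 0 := by
      intro y
      rw [Finset.sum_ite_eq]
      simp [Quotient.eq]
    simp only [h2] at this
    exact this
  · funext φ
    simp only [traceT, diagram]
    erw [sum_quotient_coloring a b r hr hle (fun ψ => if (∀ i, ψ (q' (Sum.inr i)) = φ i) then
      ∏ v, m (colorsAt p (fun x => ψ (q' (Sum.inl x))) v) else 0), Finset.sum_comm]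
    refine Finset.sum_congr rfl fun ψ _ => ?_
    rw [Finset.sum_eq_single (fun k => ψ (a k))]
    · by_cases h1 : ∀ l, ψ (a l) = ψ (b l)
      · rw [if_pos h1]
        refine if_congr ?_ rfl rfl
        constructor
        · exact fun h i => h (Sum.inl i)
        · rintro h (i | l | l)
          · exact h i
          · rfl
          · exact (h1 l).symm
      · rw [if_neg h1, if_neg]
        exact fun h => h1 fun l => (h (Sum.inr (Sum.inr l))).symm
    · intro θ _ hθ
      rw [if_neg]
      intro h
      apply hθ
      funext k
      have := h (Sum.inr (Sum.inl k))
      simpa [a] using this.symm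
    · simp

lemma Gen_one (m : Multiset (Fin n) → R) (D : Set ℕ) [IsEmpty ι] :
    (fun _ => 1 : Ten n R ι) ∈ Gen m D ι := by
  refine ⟨Empty, Empty, Empty, inferInstance, inferInstance, inferInstance, inferInstance,
    inferInstance, id, Sum.elim id isEmptyElim, fun e => e.elim, fun v => v.elim, ?_⟩
  funext φ
  simp [diagram]

lemma Gen_idT (m : Multiset (Fin n) → R) (D : Set ℕ) : idT n R ι ∈ Gen m D (ι ⊕ ι) := by
  refine ⟨Empty, Empty, ι, inferInstance, inferInstance, inferInstance, inferInstance,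
    inferInstance, Empty.elim, Sum.elim Empty.elim (Sum.elim id id), fun e => ?_,
    fun v => v.elim, ?_⟩
  · left
    rw [Fintype.sum_sum_type, Fintype.sum_sum_type]
    change _ + ((∑ a : ι, if a = e then 1 else 0) + ∑ a : ι, if a = e then 1 else 0) = 2
    simp
  · funext φ
    simp only [diagram, idT, Sum.forall, Sum.elim_inr, Sum.elim_inl, id, Finset.univ_eq_empty,
      Finset.prod_empty]
    rw [Finset.sum_eq_single (φ ∘ Sum.inl)]
    · refine if_congr ?_ rfl rfl
      simp [_root_.funext_iff]
    · intro ψ _ hψ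
      rw [if_neg]
      rintro ⟨h, -⟩
      exact hψ (funext h)
    · simp

lemma Gen_basic (m : Multiset (Fin n) → R) {D : Set ℕ} (hD : Fintype.card ι ∈ D) :
    (fun φ => m (Finset.univ.val.map φ) : Ten n R ι) ∈ Gen m D ι := by
  refine ⟨Unit, ι, ι, inferInstance, inferInstance, inferInstance, inferInstance,
    inferInstance, fun _ => (), Sum.elim id id, fun e => ?_, fun v => ?_, ?_⟩
  · left
    rw [Fintype.sum_sum_type]
    change (∑ a : ι, if a = e then 1 else 0) + (∑ a : ι, if a = e then 1 else 0) = 2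
    simp
  · simpa using hD
  · funext φ
    simp only [diagram, Sum.elim_inr, Sum.elim_inl, id]
    rw [Finset.sum_eq_single φ]
    · simp only [implies_true, if_true, Finset.univ_unique, Finset.prod_singleton, colorsAt]
      congr 1
      change _ = (Multiset.map ((fun c => ({c} : Multiset (Fin n))) ∘ φ) _).sum
      rw [← Multiset.map_map (fun c => ({c} : Multiset (Fin n))) φ, Multiset.sum_map_singleton]
    · intro ψ _ hψ
      exact if_neg fun h => hψ (funext h)
    · simp

end Diagrams

section Spans

set_option linter.unusedSectionVars false

variable {n : ℕ} {k R : Type} [Field k] [CommRing R] [Algebra k R]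
variable {ι κ : Type} [Fintype ι] [Fintype κ] [DecidableEq ι] [DecidableEq κ]

/-- A family of subspaces of the tensor spaces closed under the operations of a graded contractible
algebra containing the metric tensor. -/
structure TF (n : ℕ) (k R : Type) [Field k] [CommRing R] [Algebra k R] where
  sp : ∀ (ι : Type) [Fintype ι], Submodule k (Ten n R ι)
  relabel_mem : ∀ {ι κ : Type} [Fintype ι] [Fintype κ] (e : ι ≃ κ) {x : Ten n R ι},
    x ∈ sp ι → relabel e x ∈ sp κ
  prodT_mem : ∀ {ι κ : Type} [Fintype ι] [Fintype κ] {x : Ten n R ι} {y : Ten n R κ},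
    x ∈ sp ι → y ∈ sp κ → prodT x y ∈ sp (ι ⊕ κ)
  traceT_mem : ∀ {ι κ : Type} [Fintype ι] [Fintype κ] [DecidableEq ι] [DecidableEq κ]
    {x : Ten n R (ι ⊕ (κ ⊕ κ))}, x ∈ sp (ι ⊕ (κ ⊕ κ)) → traceT x ∈ sp ι
  one_mem : ∀ {ι : Type} [Fintype ι] [IsEmpty ι], (fun _ => 1 : Ten n R ι) ∈ sp ι
  idT_mem : ∀ {ι : Type} [Fintype ι] [DecidableEq ι], idT n R ι ∈ sp (ι ⊕ ι)

/-- The standard bilinear form is nondegenerate on each of the subspaces. -/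
def TF.Nondeg (A : TF n k R) : Prop :=
  ∀ (ι : Type) [Fintype ι] [DecidableEq ι] (x : Ten n R ι), x ∈ A.sp ι →
    (∀ y ∈ A.sp ι, pairT x y = 0) → x = 0

lemma TF.contractT_mem (A : TF n k R) {x : Ten n R (ι ⊕ κ)} {y : Ten n R κ}
    (hx : x ∈ A.sp (ι ⊕ κ)) (hy : y ∈ A.sp κ) : contractT x y ∈ A.sp ι := by
  have := A.traceT_mem (A.relabel_mem (Equiv.sumAssoc ι κ κ) (A.prodT_mem hx hy))
  convert this using 1
  funext φ
  simp only [contractT, traceT, relabel, prodT]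
  refine Finset.sum_congr rfl fun ψ _ => ?_
  congr 2
  funext i
  rcases i with i | i <;> rfl

/-- The spans of the tensors of diagrams. -/
def spanTF (k : Type) [Field k] [Algebra k R] (m : Multiset (Fin n) → R) (D : Set ℕ) :
    TF n k R where
  sp ι _ := Submodule.span k (Gen m D ι)
  relabel_mem {ι κ} _ _ e x hx := by
    classical
    refine Submodule.span_induction (p := fun x _ => relabel e x ∈ Submodule.span k (Gen m D κ))
      (fun x hx => Submodule.subset_span (Gen_relabel m e hx)) (Submodule.zero_mem _)
      (fun x y _ _ hx hy => Submodule.add_mem _ hx hy)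
      (fun c x _ hx => Submodule.smul_mem _ c hx) hx
  prodT_mem {ι κ} _ _ x y hx hy := by
    classical
    refine Submodule.span_induction
      (p := fun x _ => prodT x y ∈ Submodule.span k (Gen m D (ι ⊕ κ))) (fun x hx => ?_) ?_
      (fun x x' _ _ hx hx' => ?_) (fun c x _ hx => ?_) hx
    · refine Submodule.span_induction
        (p := fun y _ => prodT x y ∈ Submodule.span k (Gen m D (ι ⊕ κ))) (fun y hy => ?_) ?_
        (fun y y' _ _ hy hy' => ?_) (fun c y _ hy => ?_) hy
      · exact Submodule.subset_span (Gen_prodT m hx hy)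
      · convert Submodule.zero_mem _ using 1
        funext φ
        simp [prodT]
      · convert Submodule.add_mem _ hy hy' using 1
        funext φ
        simp [prodT, mul_add]
      · convert Submodule.smul_mem _ c hy using 1
        funext φ
        simp [prodT]
    · convert Submodule.zero_mem _ using 1
      funext φ
      simp [prodT]
    · convert Submodule.add_mem _ hx hx' using 1
      funext φ
      simp [prodT, add_mul]
    · convert Submodule.smul_mem _ c hx using 1
      funext φ
      simp [prodT]
  traceT_mem {ι κ} _ _ _ _ x hx := by
    refine Submodule.span_induction
      (p := fun x _ => traceT x ∈ Submodule.span k (Gen m D ι)) (fun x hx => ?_) ?_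
      (fun x x' _ _ hx hx' => ?_) (fun c x _ hx => ?_) hx
    · exact Submodule.subset_span (Gen_traceT m hx)
    · convert Submodule.zero_mem _ using 1
      funext φ
      simp [traceT]
    · convert Submodule.add_mem _ hx hx' using 1
      funext φ
      simp [traceT, Finset.sum_add_distrib]
    · convert Submodule.smul_mem _ c hx using 1
      funext φ
      simp [traceT, Finset.smul_sum]
  one_mem := Submodule.subset_span (Gen_one m D)
  idT_mem := Submodule.subset_span (Gen_idT m D)

lemma pairT_comm (x y : Ten n R ι) : pairT x y = pairT y x :=
  Finset.sum_congr rfl fun _ _ => mul_comm _ _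

/-- The standard bilinear form as a bilinear map. -/
def pairL (k : Type) [Field k] [Algebra k R] : Ten n R ι →ₗ[k] Ten n R ι →ₗ[k] R :=
  LinearMap.mk₂ k pairT
    (fun x x' y => by simp [pairT, add_mul, Finset.sum_add_distrib])
    (fun c x y => by simp [pairT, Finset.smul_sum])
    (fun x y y' => by simp [pairT, mul_add, Finset.sum_add_distrib])
    (fun c x y => by simp [pairT, Finset.smul_sum])

@[simp] lemma pairL_apply (x y : Ten n R ι) : pairL k x y = pairT x y := rfl

lemma pairT_eq_zero_of_span {s : Set (Ten n R ι)} {x : Ten n R ι}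
    (h : ∀ y ∈ s, pairT x y = 0) : ∀ y ∈ Submodule.span k s, pairT x y = 0 := fun y hy => by
  have : Submodule.span k s ≤ LinearMap.ker (pairL k x) := Submodule.span_le.2 h
  exact this hy

/-- Coordinatewise application of an algebra homomorphism. -/
def mapT {R' : Type} [CommRing R'] [Algebra k R'] (f : R →ₐ[k] R') :
    Ten n R ι →ₗ[k] Ten n R' ι where
  toFun x φ := f (x φ)
  map_add' x y := by
    funext φ
    simp
  map_smul' c x := by
    funext φ
    simp

@[simp] lemma mapT_apply {R' : Type} [CommRing R'] [Algebra k R'] (f : R →ₐ[k] R')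
    (x : Ten n R ι) (φ : ι → Fin n) : mapT f x φ = f (x φ) := rfl

lemma pairT_mapT {R' : Type} [CommRing R'] [Algebra k R'] (f : R →ₐ[k] R')
    (x y : Ten n R ι) : pairT (mapT f x) (mapT f y) = f (pairT x y) := by
  simp [pairT]

lemma linear_eq_zero_of_coordinates {K X : Type} [Field K] [Algebra k K] {Γ : Type}
    (w : Γ → X → K) (c : Γ →₀ K)
    (h : ∀ s : K →ₗ[k] k, ∀ x, c.sum (fun G a => algebraMap k K (s a) * w G x) = 0) (x : X) :
    c.sum (fun G a => a * w G x) = 0 := by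
  classical
  let b := Module.Basis.ofVectorSpace k K
  let J : Finset _ := c.support.biUnion fun G => (b.repr (c G)).support
  have h1 : ∀ G ∈ c.support, c G * w G x =
      ∑ j ∈ J, b j * (algebraMap k K (b.coord j (c G)) * w G x) := by
    intro G hG
    have : c G = ∑ j ∈ J, b.repr (c G) j • b j := by
      conv_lhs => rw [← b.linearCombination_repr (c G), Finsupp.linearCombination_apply]
      exact Finsupp.sum_of_support_subset _ (Finset.subset_biUnion_of_mem
        (fun G => (b.repr (c G)).support) hG) _ (by simp)
    conv_lhs => rw [this, Finset.sum_mul]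
    refine Finset.sum_congr rfl fun j _ => ?_
    rw [Algebra.smul_def, Module.Basis.coord_apply]
    ring
  rw [Finsupp.sum, Finset.sum_congr rfl h1, Finset.sum_comm]
  refine Finset.sum_eq_zero fun j _ => ?_
  rw [← Finset.mul_sum]
  have := h (b.coord j) x
  rw [Finsupp.sum] at this
  rw [this, mul_zero]

/-- Nondegeneracy of the span of diagram tensors is preserved by extension of the base field. -/
lemma nondeg_baseChange {K : Type} [Field K] [Algebra k K] (m : Multiset (Fin n) → R) (D : Set ℕ)
    (α : R →ₐ[k] k) (β : R →ₐ[k] K)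
    (hpair : ∀ (ι : Type) [Fintype ι] [DecidableEq ι] (x y : Ten n R ι), x ∈ Gen m D ι →
      y ∈ Gen m D ι → β (pairT x y) = algebraMap k K (α (pairT x y)))
    (hker : ∀ (ι : Type) [Fintype ι] [DecidableEq ι] (x : Ten n R ι),
      x ∈ Submodule.span k (Gen m D ι) → (∀ y ∈ Gen m D ι, α (pairT x y) = 0) →
      mapT β x = 0) :
    (spanTF K (fun d => β (m d)) D).Nondeg := by
  intro ι _ _ x hx hxy
  let w : Gen m D ι → Ten n K ι := fun G => mapT β G.1
  have hw : Set.range w = Gen (fun d => β (m d)) D ι := by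
    ext z
    constructor
    · rintro ⟨G, rfl⟩
      exact Gen_map (β : R →+* K) m G.2
    · intro hz
      obtain ⟨y, hy, rfl⟩ := exists_Gen_of_map (β : R →+* K) m hz
      exact ⟨⟨y, hy⟩, rfl⟩
  have hx' : x ∈ Submodule.span K (Set.range w) := by
    rw [hw]
    exact hx
  obtain ⟨c, rfl⟩ := (Finsupp.mem_span_range_iff_exists_finsupp).1 hx'
  have hsum : ∀ φ, (c.sum fun i a => a • w i) φ = c.sum (fun G a => a * w G φ) := by
    intro φ
    simp [Finsupp.sum]
  funext φ
  rw [hsum]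
  refine linear_eq_zero_of_coordinates (k := k) (fun G => w G) c (fun s φ => ?_) φ
  let z : Ten n R ι := c.sum fun G a => s a • G.1
  have hz : z ∈ Submodule.span k (Gen m D ι) :=
    Submodule.sum_mem _ fun G _ => Submodule.smul_mem _ _ (Submodule.subset_span G.2)
  have hz0 : mapT β z = 0 := by
    refine hker ι z hz fun y hy => ?_
    have h1 := hxy (mapT β y) (Submodule.subset_span (Gen_map (β : R →+* K) m hy))
    have h3 : pairT (c.sum fun i a => a • w i) (mapT β y) =
        c.sum fun G a => a * algebraMap k K (α (pairT G.1 y)) := by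
      rw [← pairL_apply (k := K), Finsupp.sum, map_sum, LinearMap.sum_apply]
      refine Finset.sum_congr rfl fun G _ => ?_
      rw [map_smul, LinearMap.smul_apply, pairL_apply, smul_eq_mul, pairT_mapT,
        hpair ι G.1 y G.2 hy]
    rw [h3] at h1
    have h4 := congrArg s h1
    rw [Finsupp.sum, map_sum, map_zero] at h4
    change α (pairL k (∑ G ∈ c.support, s (c G) • G.1) y) = 0
    rw [map_sum, LinearMap.sum_apply, map_sum, ← h4]
    refine Finset.sum_congr rfl fun G _ => ?_
    rw [map_smul, LinearMap.smul_apply, pairL_apply, map_smul, mul_comm, ← Algebra.smul_def,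
      map_smul, smul_eq_mul, smul_eq_mul, mul_comm]
  have := congrFun hz0 φ
  simp only [z, Finsupp.sum, map_sum, map_smul, Finset.sum_apply, Pi.smul_apply] at this
  simp only [Algebra.smul_def] at this
  exact this

lemma Gen_empty_eq (m m' : Multiset (Fin n) → R) : Gen m ∅ ι = Gen m' ∅ ι := by
  have : ∀ m m' : Multiset (Fin n) → R, Gen m ∅ ι ⊆ Gen m' ∅ ι := by
    rintro m m' x ⟨V, H, E, _, _, _, _, _, p, q, hq, hp, rfl⟩
    refine ⟨V, H, E, inferInstance, inferInstance, inferInstance, inferInstance, inferInstance,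
      p, q, hq, hp, ?_⟩
    have : IsEmpty V := ⟨fun v => hp v⟩
    funext φ
    simp [diagram]
  exact (this m m').antisymm (this m' m)

/-- The spans of the tensors of perfect matchings. -/
def matchTF (n : ℕ) (k R : Type) [Field k] [CommRing R] [Algebra k R] : TF n k R :=
  spanTF k (fun _ => 0) ∅

lemma matchTF_eq (m : Multiset (Fin n) → R) : matchTF n k R = spanTF k m ∅ := by
  have : ∀ (ι : Type) [Fintype ι], Gen (fun _ => (0 : R)) ∅ ι = Gen m ∅ ι := by
    intro ι _
    classical
    exact Gen_empty_eq _ _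
  simp only [matchTF, spanTF, this]

lemma matchTF_le (m : Multiset (Fin n) → R) (D : Set ℕ) :
    (matchTF n k R).sp ι ≤ (spanTF k m D).sp ι := by
  rw [matchTF_eq m]
  exact Submodule.span_mono (Gen_mono m (Set.empty_subset D))

lemma matchTF_nondeg (n : ℕ) (K : Type) [Field K] [CharZero K] : (matchTF n K K).Nondeg := by
  have := nondeg_baseChange (n := n) (k := ℚ) (R := ℚ) (K := K) (fun _ => 0) ∅
    (AlgHom.id ℚ ℚ) (Algebra.ofId ℚ K) (fun ι _ _ x y _ _ => rfl) (fun ι _ _ x hx h => by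
      have h0 : pairT x x = 0 := pairT_eq_zero_of_span (k := ℚ) h x hx
      have : x = 0 := by
        funext φ
        have := (Finset.sum_eq_zero_iff_of_nonneg (fun φ _ => mul_self_nonneg (x φ))).1 h0 φ
          (Finset.mem_univ _)
        simpa using this
      rw [this, map_zero])
  rwa [← matchTF_eq] at this

end Spans

noncomputable section Haar

set_option linter.unusedSectionVars false

variable {n : ℕ} {K : Type} [Field K]
variable {ι κ : Type} [Fintype ι] [Fintype κ] [DecidableEq ι] [DecidableEq κ]

/-- The coordinate ring of the space of matrices. -/
abbrev Mat (n : ℕ) (K : Type) [Field K] : Type := MvPolynomial (Fin n × Fin n) K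

/-- The matrix coefficients of the tensor powers, as monomials in the matrix entries. -/
def mon (K : Type) [Field K] (φ ψ : ι → Fin n) : Mat n K := ∏ s, X (φ s, ψ s)

/-- The basis tensor `e_ψ`. -/
def basT (K : Type) [Field K] (ψ : ι → Fin n) : Ten n K ι := Pi.single ψ 1

/-- The coordinate at `φ` of the image of the tensor `a` under a generic matrix. -/
def pol : Ten n K ι →ₗ[K] (ι → Fin n) → Mat n K where
  toFun a φ := ∑ ψ, a ψ • mon K φ ψ
  map_add' a b := by
    funext φ
    simp [add_smul, Finset.sum_add_distrib]
  map_smul' c a := by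
    funext φ
    simp [mul_smul, Finset.smul_sum]

lemma pol_apply (a : Ten n K ι) (φ : ι → Fin n) : pol a φ = ∑ ψ, a ψ • mon K φ ψ := rfl

lemma sum_smul_basT (a : Ten n K ι) : ∑ ψ, a ψ • basT K ψ = a := by
  funext φ
  simp [basT, Finset.sum_apply, Pi.single_apply]

lemma pol_basT (φ ψ : ι → Fin n) : pol (basT K ψ) φ = mon K φ ψ := by
  rw [pol_apply, Finset.sum_eq_single ψ]
  · simp [basT]
  · intro b _ hb
    simp [basT, hb]
  · simp

lemma mon_elim (φ ψ : ι → Fin n) (φ' ψ' : κ → Fin n) :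
    mon K (Sum.elim φ φ') (Sum.elim ψ ψ') = mon K φ ψ * mon K φ' ψ' := by
  simp [mon, Fintype.prod_sum_type]

lemma mon_relabel (e : ι ≃ κ) (φ ψ : κ → Fin n) : mon K (φ ∘ e) (ψ ∘ e) = mon K φ ψ :=
  Equiv.prod_comp e fun s => (X (φ s, ψ s) : Mat n K)

lemma sum_elim_coloring {M : Type} [AddCommMonoid M] (f : (ι ⊕ κ → Fin n) → M) :
    ∑ φ, f φ = ∑ φ, ∑ ψ, f (Sum.elim φ ψ) := by
  rw [← Equiv.sum_comp (Equiv.sumArrowEquivProdArrow ι κ (Fin n)).symm, Fintype.sum_prod_type]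
  rfl

lemma pol_prodT (a : Ten n K ι) (b : Ten n K κ) (φ : ι → Fin n) (φ' : κ → Fin n) :
    pol (prodT a b) (Sum.elim φ φ') = pol a φ * pol b φ' := by
  simp only [pol_apply]
  rw [sum_elim_coloring, Finset.sum_mul_sum]
  refine Finset.sum_congr rfl fun ψ _ => Finset.sum_congr rfl fun ψ' _ => ?_
  rw [mon_elim, smul_mul_smul_comm]
  rfl

lemma sum_relabel {M : Type} [AddCommMonoid M] (e : ι ≃ κ) (f : (ι → Fin n) → M) :
    ∑ φ : κ → Fin n, f (φ ∘ e) = ∑ φ, f φ :=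
  Equiv.sum_comp (Equiv.arrowCongr e (Equiv.refl (Fin n))).symm f

lemma pol_relabel (e : ι ≃ κ) (a : Ten n K ι) (φ : κ → Fin n) :
    pol (relabel e a) φ = pol a (φ ∘ e) := by
  simp only [pol_apply]
  rw [← sum_relabel e]
  refine Finset.sum_congr rfl fun ψ _ => ?_
  rw [mon_relabel]
  rfl

lemma monomial_eq_mon (d : Fin n × Fin n →₀ ℕ) :
    (monomial d 1 : Mat n K) =
      mon K (ι := Σ p, Fin (d p)) (fun s => s.1.1) (fun s => s.1.2) := by
  rw [mon, Fintype.prod_sigma]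
  simp only [Prod.mk.eta, Finset.prod_const, Finset.card_univ, Fintype.card_fin]
  rw [monomial_eq, Finsupp.prod_fintype _ _ (by simp)]
  simp

lemma mon_eq_monomial (φ ψ : ι → Fin n) :
    mon K φ ψ = monomial (∑ s, Finsupp.single (φ s, ψ s) 1) 1 := by
  rw [mon, monomial_sum_one]
  rfl

/-- Linear maps out of the coordinate ring of matrices are given by natural families. -/
lemma exists_linear_of_natural {M : Type} [AddCommGroup M] [Module K M]
    (Λ : ∀ (ι : Type) [Fintype ι] [DecidableEq ι], (ι → Fin n) → (ι → Fin n) → M)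
    (hΛ : ∀ (ι κ : Type) [Fintype ι] [DecidableEq ι] [Fintype κ] [DecidableEq κ] (e : ι ≃ κ)
      (φ ψ : κ → Fin n), Λ ι (φ ∘ e) (ψ ∘ e) = Λ κ φ ψ) :
    ∃ L : Mat n K →ₗ[K] M, ∀ (ι : Type) [Fintype ι] [DecidableEq ι] (φ ψ : ι → Fin n),
      L (mon K φ ψ) = Λ ι φ ψ := by
  refine ⟨(basisMonomials (Fin n × Fin n) K).constr K fun d =>
    Λ (Σ p, Fin (d p)) (fun s => s.1.1) (fun s => s.1.2), fun ι _ _ φ ψ => ?_⟩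
  let d : Fin n × Fin n →₀ ℕ := ∑ s, Finsupp.single (φ s, ψ s) 1
  have h1 : mon K φ ψ = basisMonomials (Fin n × Fin n) K d := by
    rw [mon_eq_monomial, coe_basisMonomials]
  rw [h1, Module.Basis.constr_basis]
  have hd : ∀ p, Fintype.card {s // (φ s, ψ s) = p} = d p := by
    intro p
    simp only [d, Finsupp.finsetSum_apply, Finsupp.single_apply, Finset.sum_boole,
      Fintype.card_subtype]
    simp
  let e : (Σ p, Fin (d p)) ≃ ι :=
    (Equiv.sigmaCongrRight fun p => (Fintype.equivFinOfCardEq (hd p)).symm).trans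
      (Equiv.sigmaFiberEquiv fun s => (φ s, ψ s))
  have he : ∀ x, (φ (e x), ψ (e x)) = x.1 := by
    rintro ⟨p, i⟩
    exact ((Fintype.equivFinOfCardEq (hd p)).symm i).2
  rw [← hΛ _ _ e φ ψ]
  congr 1
  · funext x
    exact (congrArg Prod.fst (he x)).symm
  · funext x
    exact (congrArg Prod.snd (he x)).symm

lemma linear_ext_mon {M : Type} [AddCommGroup M] [Module K M] {L L' : Mat n K →ₗ[K] M}
    (h : ∀ (ι : Type) [Fintype ι] [DecidableEq ι] (φ ψ : ι → Fin n),
      L (mon K φ ψ) = L' (mon K φ ψ)) : L = L' := by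
  refine (basisMonomials (Fin n × Fin n) K).ext fun d => ?_
  rw [coe_basisMonomials]
  beta_reduce
  rw [monomial_eq_mon]
  exact h _ _ _

variable {A : TF n K K}

lemma TF.Nondeg.bijective (hA : A.Nondeg) : Function.Bijective
    (((pairL K (ι := ι)).domRestrict₁₂ (A.sp ι) (A.sp ι) : _ →ₗ[K] _ →ₗ[K] K)) := by
  have hinj : Function.Injective
      (((pairL K (ι := ι)).domRestrict₁₂ (A.sp ι) (A.sp ι) : _ →ₗ[K] _ →ₗ[K] K)) := by
    rw [injective_iff_map_eq_zero]
    rintro ⟨x, hx⟩ h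
    rw [Submodule.mk_eq_zero]
    exact hA ι x hx fun y hy => LinearMap.congr_fun h ⟨y, hy⟩
  exact ⟨hinj, (LinearMap.injective_iff_surjective_of_finrank_eq_finrank
    Subspace.dual_finrank_eq.symm).1 hinj⟩

/-- The orthogonal projection onto a nondegenerate family of subspaces. -/
def TF.Nondeg.proj (hA : A.Nondeg) : Ten n K ι →ₗ[K] Ten n K ι :=
  (A.sp ι).subtype ∘ₗ ((LinearEquiv.ofBijective _ (hA.bijective (ι := ι))).symm : _ →ₗ[K] _) ∘ₗ
    (A.sp ι).subtype.dualMap ∘ₗ pairL K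

lemma TF.Nondeg.proj_mem (hA : A.Nondeg) (x : Ten n K ι) : hA.proj x ∈ A.sp ι :=
  ((LinearEquiv.ofBijective _ (hA.bijective (ι := ι))).symm _).2

lemma TF.Nondeg.pairT_proj (hA : A.Nondeg) (x : Ten n K ι) {y : Ten n K ι} (hy : y ∈ A.sp ι) :
    pairT (hA.proj x) y = pairT x y := by
  have := LinearEquiv.apply_symm_apply (LinearEquiv.ofBijective _ (hA.bijective (ι := ι)))
    ((A.sp ι).subtype.dualMap (pairL K x))
  exact LinearMap.congr_fun this ⟨y, hy⟩

lemma TF.Nondeg.proj_eq (hA : A.Nondeg) {x w : Ten n K ι} (hw : w ∈ A.sp ι)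
    (h : ∀ y ∈ A.sp ι, pairT w y = pairT x y) : hA.proj x = w := by
  rw [← sub_eq_zero]
  refine hA ι _ (Submodule.sub_mem _ (hA.proj_mem x) hw) fun y hy => ?_
  rw [← pairL_apply (k := K), map_sub, LinearMap.sub_apply, pairL_apply, pairL_apply,
    hA.pairT_proj x hy, h y hy, sub_self]

lemma TF.Nondeg.proj_of_mem (hA : A.Nondeg) {x : Ten n K ι} (hx : x ∈ A.sp ι) : hA.proj x = x :=
  hA.proj_eq hx fun _ _ => rfl

lemma pairT_relabel {R : Type} [CommRing R] (e : ι ≃ κ) (x y : Ten n R ι) :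
    pairT (relabel e x) (relabel e y) = pairT x y :=
  sum_relabel e fun φ => x φ * y φ

lemma relabel_symm_relabel {R : Type} [CommRing R] (e : ι ≃ κ) (x : Ten n R κ) :
    relabel e (relabel e.symm x) = x := by
  funext φ
  simp only [relabel]
  congr 1
  funext i
  simp

lemma TF.Nondeg.proj_relabel (hA : A.Nondeg) (e : ι ≃ κ) (x : Ten n K ι) :
    hA.proj (relabel e x) = relabel e (hA.proj x) := by
  refine hA.proj_eq (A.relabel_mem e (hA.proj_mem x)) fun y hy => ?_
  rw [← relabel_symm_relabel e y, pairT_relabel, pairT_relabel,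
    hA.pairT_proj _ (A.relabel_mem _ hy)]

lemma pairT_prodT {R : Type} [CommRing R] (x : Ten n R ι) (a : Ten n R κ) (y : Ten n R (ι ⊕ κ)) :
    pairT (prodT x a) y = pairT x (contractT y a) := by
  simp only [pairT, contractT]
  rw [sum_elim_coloring]
  refine Finset.sum_congr rfl fun φ _ => ?_
  rw [Finset.mul_sum]
  refine Finset.sum_congr rfl fun ψ _ => ?_
  simp only [prodT, Sum.elim_comp_inl, Sum.elim_comp_inr]
  ring

lemma TF.Nondeg.proj_prodT (hA : A.Nondeg) (x : Ten n K ι) {a : Ten n K κ} (ha : a ∈ A.sp κ) :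
    hA.proj (prodT x a) = prodT (hA.proj x) a := by
  refine hA.proj_eq (A.prodT_mem (hA.proj_mem x) ha) fun y hy => ?_
  rw [pairT_prodT, pairT_prodT, hA.pairT_proj _ (A.contractT_mem hy ha)]

lemma relabel_basT (e : ι ≃ κ) (ψ : κ → Fin n) :
    relabel e (basT K (ψ ∘ e)) = basT K ψ := by
  funext φ
  simp only [relabel, basT, Pi.single_apply]
  refine if_congr ?_ rfl rfl
  constructor
  · intro h
    funext i
    have := congrFun h (e.symm i)
    simpa using this
  · rintro rfl
    rfl

lemma TF.Nondeg.exists_haar (hA : A.Nondeg) : ∃ L : Mat n K →ₗ[K] K,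
    ∀ (ι : Type) [Fintype ι] [DecidableEq ι] (φ ψ : ι → Fin n),
      L (mon K φ ψ) = hA.proj (basT K ψ) φ := by
  refine exists_linear_of_natural (fun ι _ _ φ ψ => hA.proj (basT K ψ) φ) ?_
  intro ι κ _ _ _ _ e φ ψ
  conv_rhs => rw [← relabel_basT e ψ, hA.proj_relabel]
  rfl

/-- The normalised invariant functional on the coordinate ring of matrices. -/
def TF.Nondeg.haar (hA : A.Nondeg) : Mat n K →ₗ[K] K := hA.exists_haar.choose

lemma TF.Nondeg.haar_mon (hA : A.Nondeg) (φ ψ : ι → Fin n) :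
    hA.haar (mon K φ ψ) = hA.proj (basT K ψ) φ := hA.exists_haar.choose_spec ι φ ψ

lemma TF.Nondeg.haar_pol (hA : A.Nondeg) (a : Ten n K ι) (φ : ι → Fin n) :
    hA.haar (pol a φ) = hA.proj a φ := by
  conv_rhs => rw [← sum_smul_basT a, map_sum, Finset.sum_apply]
  rw [pol_apply, map_sum]
  refine Finset.sum_congr rfl fun ψ _ => ?_
  rw [map_smul, map_smul, hA.haar_mon]
  rfl

lemma TF.Nondeg.haar_one (hA : A.Nondeg) : hA.haar 1 = 1 := by
  have := hA.haar_pol (ι := Empty) (fun _ => 1) (fun i => i.elim)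
  rw [hA.proj_of_mem A.one_mem] at this
  refine Eq.trans ?_ this
  congr 1
  simp [pol_apply, mon]

/-- The ideal of equations `g a = a` for all tensors `a` of the family. -/
def TF.fixIdeal (A : TF n K K) : Ideal (Mat n K) :=
  Ideal.span {p | ∃ (ι : Type) (_ : Fintype ι) (_ : DecidableEq ι) (a : Ten n K ι)
    (φ : ι → Fin n), a ∈ A.sp ι ∧ p = pol a φ - C (a φ)}

lemma TF.pol_sub_mem_fixIdeal {a : Ten n K ι} (ha : a ∈ A.sp ι) (φ : ι → Fin n) :
    pol a φ - C (a φ) ∈ A.fixIdeal :=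
  Ideal.subset_span ⟨ι, inferInstance, inferInstance, a, φ, ha, rfl⟩

lemma TF.Nondeg.haar_mul_pol (hA : A.Nondeg) (r : Mat n K) {a : Ten n K ι} (ha : a ∈ A.sp ι)
    (φ : ι → Fin n) : hA.haar (r * pol a φ) = hA.haar r * a φ := by
  have : hA.haar ∘ₗ LinearMap.mulRight K (pol a φ) = LinearMap.mulRight K (a φ) ∘ₗ hA.haar := by
    refine linear_ext_mon fun κ _ _ φ' ψ' => ?_
    simp only [LinearMap.comp_apply, LinearMap.mulRight_apply]
    rw [← pol_basT, ← pol_prodT, hA.haar_pol, hA.haar_pol, hA.proj_prodT _ ha]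
    rfl
  exact LinearMap.congr_fun this r

lemma TF.Nondeg.haar_fixIdeal (hA : A.Nondeg) {p : Mat n K} (hp : p ∈ A.fixIdeal) :
    hA.haar p = 0 := by
  refine Submodule.span_induction (p := fun p _ => ∀ r, hA.haar (r * p) = 0) ?_ (by simp)
    (fun x y _ _ hx hy r => by rw [mul_add, map_add, hx, hy, add_zero])
    (fun c x _ hx r => by rw [smul_eq_mul, ← mul_assoc, hx]) hp 1 |> fun h => by
      rwa [one_mul] at h
  rintro _ ⟨ι, _, _, a, φ, ha, rfl⟩ r
  rw [mul_sub, map_sub, hA.haar_mul_pol r ha, mul_comm r, ← smul_eq_C_mul, map_smul, smul_eq_mul,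
    mul_comm, sub_self]

lemma TF.Nondeg.exists_reynolds (hA : A.Nondeg) : ∃ L : Mat n K →ₗ[K] Mat n K,
    ∀ (ι : Type) [Fintype ι] [DecidableEq ι] (φ ψ : ι → Fin n),
      L (mon K φ ψ) = pol (hA.proj (basT K ψ)) φ := by
  refine exists_linear_of_natural (fun ι _ _ φ ψ => pol (hA.proj (basT K ψ)) φ) ?_
  intro ι κ _ _ _ _ e φ ψ
  conv_rhs => rw [← relabel_basT e ψ, hA.proj_relabel, pol_relabel]

/-- The Reynolds operator for right translations on the coordinate ring of matrices. -/
def TF.Nondeg.reynolds (hA : A.Nondeg) : Mat n K →ₗ[K] Mat n K := hA.exists_reynolds.choose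

lemma TF.Nondeg.reynolds_mon (hA : A.Nondeg) (φ ψ : ι → Fin n) :
    hA.reynolds (mon K φ ψ) = pol (hA.proj (basT K ψ)) φ := hA.exists_reynolds.choose_spec ι φ ψ

lemma TF.Nondeg.reynolds_pol (hA : A.Nondeg) (a : Ten n K ι) (φ : ι → Fin n) :
    hA.reynolds (pol a φ) = pol (hA.proj a) φ := by
  conv_rhs => rw [← sum_smul_basT a, map_sum, map_sum, Finset.sum_apply]
  rw [pol_apply, map_sum]
  refine Finset.sum_congr rfl fun ψ _ => ?_
  rw [map_smul, map_smul, map_smul, hA.reynolds_mon]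
  rfl

lemma TF.Nondeg.reynolds_mul_pol (hA : A.Nondeg) (r : Mat n K) {a : Ten n K ι}
    (ha : a ∈ A.sp ι) (φ : ι → Fin n) :
    hA.reynolds (r * pol a φ) = hA.reynolds r * pol a φ := by
  have : hA.reynolds ∘ₗ LinearMap.mulRight K (pol a φ) =
      LinearMap.mulRight K (pol a φ) ∘ₗ hA.reynolds := by
    refine linear_ext_mon fun κ _ _ φ' ψ' => ?_
    simp only [LinearMap.comp_apply, LinearMap.mulRight_apply]
    rw [← pol_basT, ← pol_prodT, hA.reynolds_pol, hA.reynolds_pol, hA.proj_prodT _ ha, pol_prodT]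
  exact LinearMap.congr_fun this r

end Haar

noncomputable section Orthogonal

set_option linter.unusedSectionVars false

variable {n : ℕ} {Q : Type} [CommRing Q]
variable {ι κ : Type} [Fintype ι] [Fintype κ] [DecidableEq ι] [DecidableEq κ]

lemma sum_prod_weights_fibre {X E : Type} [Fintype X] [Fintype E] [DecidableEq E]
    (q : X → E) (w : X → Fin n → Q) :
    ∑ ψ : E → Fin n, ∏ x, w x (ψ (q x)) = ∏ e, ∑ c, ∏ x with q x = e, w x c := by
  rw [Finset.prod_univ_sum]
  simp only [Fintype.piFinset_univ]
  refine Finset.sum_congr rfl fun ψ _ => ?_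
  rw [← Finset.prod_fiberwise Finset.univ q]
  refine Finset.prod_congr rfl fun e _ => Finset.prod_congr rfl fun x hx => ?_
  rw [(Finset.mem_filter.1 hx).2]

lemma sum_prod_weights_congr {X E : Type} [Fintype X] [Fintype E] [DecidableEq E]
    (q : X → E) (hq : Paired q) (w w' : X → Fin n → Q)
    (h : ∀ x y, ∑ c, w x c * w y c = ∑ c, w' x c * w' y c) :
    ∑ ψ : E → Fin n, ∏ x, w x (ψ (q x)) = ∑ ψ : E → Fin n, ∏ x, w' x (ψ (q x)) := by
  classical
  rw [sum_prod_weights_fibre, sum_prod_weights_fibre]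
  refine Finset.prod_congr rfl fun e _ => ?_
  have he := hq e
  rw [← Finset.sum_filter, ← Finset.card_eq_sum_ones] at he
  rcases he with he | he
  · obtain ⟨x, y, hxy, he⟩ := Finset.card_eq_two.1 he
    simp only [he, Finset.prod_pair hxy]
    exact h x y
  · rw [Finset.card_eq_zero] at he
    simp [he]

/-- The action of a matrix on tensors. -/
def actT (g : Fin n → Fin n → Q) (x : Ten n Q ι) : Ten n Q ι :=
  fun φ => ∑ ψ, (∏ s, g (φ s) (ψ s)) * x ψ

/-- The action of a matrix on functions on multisets of colours, as a relation. -/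
def ActsTo (g : Fin n → Fin n → Q) (m m' : Multiset (Fin n) → Q) : Prop :=
  ∀ (ι : Type) [Fintype ι] [DecidableEq ι] (φ : ι → Fin n),
    m' (Finset.univ.val.map φ) = actT g (fun ψ : ι → Fin n => m (Finset.univ.val.map ψ)) φ

lemma colorsAt_eq {H V C : Type} [Fintype H] [DecidableEq V] (p : H → V) (c : H → C) (v : V) :
    colorsAt p c v = (Finset.univ : Finset {x // p x = v}).val.map fun x => c x.1 := by
  rw [colorsAt, ← Finset.sum_filter, Finset.sum_subtype (p := fun x => p x = v) _ (by simp)]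
  change (Multiset.map ((fun c => ({c} : Multiset C)) ∘ fun x : {x // p x = v} => c x.1) _).sum = _
  rw [← Multiset.map_map (fun c => ({c} : Multiset C)), Multiset.sum_map_singleton]

/-- Functions on the total space are families of functions on the fibres. -/
def fibreArrowEquiv {H V C : Type} (p : H → V) : (∀ v, {x // p x = v} → C) ≃ (H → C) where
  toFun f x := f (p x) ⟨x, rfl⟩
  invFun f _ x := f x.1
  left_inv f := by
    funext v ⟨x, hx⟩
    subst hx
    rfl
  right_inv _ := rfl

lemma prod_colorsAt_actsTo {H V : Type} [Fintype H] [Fintype V] [DecidableEq H] [DecidableEq V]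
    (p : H → V) {g : Fin n → Fin n → Q} {m m' : Multiset (Fin n) → Q} (hm : ActsTo g m m')
    (θ : H → Fin n) :
    ∏ v, m' (colorsAt p θ v) =
      ∑ θ' : H → Fin n, (∏ x, g (θ x) (θ' x)) * ∏ v, m (colorsAt p θ' v) := by
  simp only [colorsAt_eq]
  have h1 : ∀ v, m' ((Finset.univ : Finset {x // p x = v}).val.map fun x => θ x.1) = _ :=
    fun v => hm _ _
  simp only [h1, actT]
  rw [Finset.prod_univ_sum, Fintype.piFinset_univ, ← (fibreArrowEquiv p).sum_comp]
  refine Finset.sum_congr rfl fun f _ => ?_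
  rw [Finset.prod_mul_distrib]
  congr 1
  · rw [← Finset.prod_fiberwise Finset.univ p]
    refine Finset.prod_congr rfl fun v _ => ?_
    rw [Finset.prod_subtype (p := fun x => p x = v) _ (by simp)]
    refine Finset.prod_congr rfl fun ⟨x, hx⟩ _ => ?_
    subst hx
    rfl
  · refine Finset.prod_congr rfl fun v _ => ?_
    congr 2
    funext ⟨x, hx⟩
    subst hx
    rfl

/-- Diagrams are equivariant under the orthogonal group. -/
lemma diagram_actsTo {V H E : Type} [Fintype V] [Fintype H] [Fintype E] [DecidableEq V]
    [DecidableEq E] (p : H → V) (q : H ⊕ ι → E) (hq : Paired q) {g : Fin n → Fin n → Q}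
    (hg : ∀ i j, ∑ c, g i c * g j c = if i = j then 1 else 0)
    (hg' : ∀ i j, ∑ c, g c i * g c j = if i = j then 1 else 0)
    {m m' : Multiset (Fin n) → Q} (hm : ActsTo g m m') :
    diagram m' p q = actT g (diagram m p q) := by
  classical
  funext φ
  have h1 : diagram m' p q φ = ∑ θ : H → Fin n, (∏ v, m (colorsAt p θ v)) *
      ∑ ψ : E → Fin n, ∏ x, (Sum.elim (fun x c => g c (θ x))
        (fun s c => if c = φ s then 1 else 0) : H ⊕ ι → Fin n → Q) x (ψ (q x)) := by
    simp only [diagram, Finset.mul_sum]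
    rw [Finset.sum_comm]
    refine Finset.sum_congr rfl fun ψ _ => ?_
    rw [prod_colorsAt_actsTo p hm]
    simp only [Fintype.prod_sum_type, Sum.elim_inl, Sum.elim_inr, Finset.prod_ite_zero,
      Finset.prod_const_one, Finset.mem_univ, true_imp_iff]
    split_ifs
    · exact Finset.sum_congr rfl fun θ _ => by ring
    · simp
  have h2 : actT g (diagram m p q) φ = ∑ θ : H → Fin n, (∏ v, m (colorsAt p θ v)) *
      ∑ ψ : E → Fin n, ∏ x, (Sum.elim (fun x c => if c = θ x then 1 else 0)
        (fun s c => g (φ s) c) : H ⊕ ι → Fin n → Q) x (ψ (q x)) := by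
    simp only [diagram, actT, Finset.mul_sum]
    rw [Finset.sum_comm, Finset.sum_comm (s := (Finset.univ : Finset (H → Fin n)))]
    refine Finset.sum_congr rfl fun ψ _ => ?_
    rw [Finset.sum_eq_single fun s => ψ (q (Sum.inr s)),
      Finset.sum_eq_single fun x => ψ (q (Sum.inl x))]
    · simp [mul_comm]
    · intro θ _ hθ
      obtain ⟨x, hx⟩ := Function.ne_iff.1 hθ
      rw [Finset.prod_eq_zero (Finset.mem_univ (Sum.inl x)), mul_zero]
      exact if_neg fun h => hx h.symm
    · simp
    · intro φ' _ hφ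
      rw [if_neg, mul_zero]
      intro h
      exact hφ (funext fun s => (h s).symm)
    · simp
  rw [h1, h2]
  refine Finset.sum_congr rfl fun θ _ => congrArg _ ?_
  refine sum_prod_weights_congr q hq _ _ ?_
  rintro (x | s) (y | t)
  · simp [hg', eq_comm]
  · simp
  · simp
  · simp [hg, eq_comm]

/-- The values on monomials of a linear functional on polynomials. -/
def valM (L : MvPolynomial (Fin n) Q →ₗ[Q] Q) (d : Multiset (Fin n)) : Q := L (d.map X).prod

lemma prod_map_X (d : Multiset (Fin n)) :
    ((d.map X).prod : MvPolynomial (Fin n) Q) = monomial (Multiset.toFinsupp d) 1 := by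
  induction d using Multiset.induction with
  | empty => simp
  | cons a s ih =>
    rw [Multiset.map_cons, Multiset.prod_cons, ih, ← Multiset.singleton_add, map_add, X,
      monomial_mul, one_mul, Multiset.toFinsupp_singleton]

lemma exists_valM (m : Multiset (Fin n) → Q) : ∃ L, valM L = m := by
  refine ⟨(basisMonomials (Fin n) Q).constr Q fun d => m (Finsupp.toMultiset d), ?_⟩
  funext d
  rw [valM, prod_map_X]
  have := (basisMonomials (Fin n) Q).constr_basis Q (fun d => m (Finsupp.toMultiset d))
    (Multiset.toFinsupp d)
  rw [coe_basisMonomials] at this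
  simpa using this

lemma valM_injective {L L' : MvPolynomial (Fin n) Q →ₗ[Q] Q} (h : valM L = valM L') : L = L' := by
  refine (basisMonomials (Fin n) Q).ext fun d => ?_
  have := congrFun h (Finsupp.toMultiset d)
  simp only [valM, prod_map_X] at this
  simpa using this

lemma actsTo_valM (g : Fin n → Fin n → Q) (L : MvPolynomial (Fin n) Q →ₗ[Q] Q) :
    ActsTo g (valM L)
      (valM (L ∘ₗ (aeval fun i => ∑ j, C (g i j) * X j).toLinearMap)) := by
  intro ι _ _ φ
  simp only [valM, actT, LinearMap.comp_apply, AlgHom.toLinearMap_apply, Multiset.map_map]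
  change L (aeval _ (∏ s, X (φ s))) = _
  rw [map_prod]
  simp only [aeval_X]
  rw [Finset.prod_univ_sum, Fintype.piFinset_univ, map_sum]
  refine Finset.sum_congr rfl fun ψ _ => ?_
  rw [Finset.prod_mul_distrib, ← map_prod, ← smul_eq_C_mul, map_smul, smul_eq_mul]
  rfl

lemma exists_actsTo (g : Fin n → Fin n → Q) (m : Multiset (Fin n) → Q) : ∃ m', ActsTo g m m' := by
  obtain ⟨L, rfl⟩ := exists_valM m
  exact ⟨_, actsTo_valM g L⟩

end Orthogonal

noncomputable section Universal

set_option linter.unusedSectionVars false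

variable {n : ℕ} {k R R' : Type} [Field k] [CommRing R] [Algebra k R] [CommRing R'] [Algebra k R']
variable {ι κ : Type} [Fintype ι] [Fintype κ] [DecidableEq ι] [DecidableEq κ]

lemma map_span_Gen (f : R →ₐ[k] R') (m : Multiset (Fin n) → R) (D : Set ℕ) :
    (Submodule.span k (Gen m D ι)).map (mapT f) =
      Submodule.span k (Gen (fun d => f (m d)) D ι) := by
  rw [Submodule.map_span]
  congr 1
  ext z
  constructor
  · rintro ⟨x, hx, rfl⟩
    exact Gen_map (f : R →+* R') m hx
  · intro hz
    obtain ⟨y, hy, rfl⟩ := exists_Gen_of_map (f : R →+* R') m hz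
    exact ⟨y, hy, rfl⟩

lemma mapT_prodT (f : R →ₐ[k] R') (x : Ten n R ι) (y : Ten n R κ) :
    mapT f (prodT x y) = prodT (mapT f x) (mapT f y) := by
  funext φ
  simp [prodT]

lemma mapT_contractT (f : R →ₐ[k] R') (x : Ten n R (ι ⊕ κ)) (y : Ten n R κ) :
    mapT f (contractT x y) = contractT (mapT f x) (mapT f y) := by
  funext φ
  simp [contractT]

lemma TF.pairT_mem (A : TF n k R) {x y : Ten n R ι} (hx : x ∈ A.sp ι) (hy : y ∈ A.sp ι) :
    (fun _ => pairT x y) ∈ A.sp Empty := by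
  convert A.contractT_mem (A.relabel_mem (Equiv.emptySum Empty ι).symm hx) hy using 1
  funext φ
  refine Finset.sum_congr rfl fun ψ _ => ?_
  rfl

variable {K : Type} [Field K]

lemma TF.orthogonal_mem_fixIdeal (A : TF n K K) (i j : Fin n) :
    (∑ c, X (i, c) * X (j, c) : Mat n K) - C (if i = j then 1 else 0) ∈ A.fixIdeal := by
  convert A.pol_sub_mem_fixIdeal (A.idT_mem (ι := Unit)) (Sum.elim (fun _ => i) fun _ => j) using 2
  · rw [pol_apply, sum_elim_coloring]
    rw [← (Equiv.funUnique Unit (Fin n)).symm.sum_comp]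
    refine Finset.sum_congr rfl fun c _ => ?_
    rw [Finset.sum_eq_single (fun _ => c)]
    · simp [idT, mon]
      rfl
    · intro b _ hb
      have : ¬ ((fun _ => c) = b) := fun h => hb h.symm
      simp only [idT, Sum.elim_comp_inl, Sum.elim_comp_inr]
      erw [if_neg this, zero_smul]
    · simp
  · simp only [idT, Sum.elim_comp_inl, Sum.elim_comp_inr]
    congr 2
    simp [_root_.funext_iff]

/-- The generic matrix on the zero locus of the fixing ideal. -/
def TF.genericMat (A : TF n K K) (i j : Fin n) : Mat n K ⧸ A.fixIdeal :=
  Ideal.Quotient.mk _ (X (i, j))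

lemma TF.genericMat_row (A : TF n K K) (i j : Fin n) :
    ∑ c, A.genericMat i c * A.genericMat j c = if i = j then 1 else 0 := by
  have := (Ideal.Quotient.mk_eq_mk_iff_sub_mem _ _).2 (A.orthogonal_mem_fixIdeal i j)
  simp only [map_sum, map_mul] at this
  refine Eq.trans this ?_
  split_ifs <;> simp

lemma orthogonal_col {Q : Type} [CommRing Q] {g : Fin n → Fin n → Q}
    (h : ∀ i j, ∑ c, g i c * g j c = if i = j then 1 else 0) (i j : Fin n) :
    ∑ c, g c i * g c j = if i = j then 1 else 0 := by
  have h1 : (Matrix.of g) * (Matrix.of g).transpose = 1 := by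
    ext i j
    simp [Matrix.mul_apply, h, Matrix.one_apply]
  have h2 := congrArg (fun M : Matrix (Fin n) (Fin n) Q => M i j) (mul_eq_one_comm.1 h1)
  simpa [Matrix.mul_apply, Matrix.one_apply] using h2

/-- The ring of coordinates on the space of vertex models. -/
abbrev ModelRing (n : ℕ) (k : Type) [Field k] : Type := MvPolynomial (Multiset (Fin n)) k

/-- The vertex model `m` paired with the universal vertex model. -/
def pairModel (m : Multiset (Fin n) → k) (d : Multiset (Fin n)) : k × ModelRing n k := (m d, X d)

/-- The spans of the diagrams of the paired vertex model. -/
def pairTF (m : Multiset (Fin n) → k) : TF n k (k × ModelRing n k) :=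
  spanTF k (pairModel m) Set.univ

/-- The ideal of vertex models that kill all combinations of diagrams in the radical of the form
for `m`. -/
def radIdeal (m : Multiset (Fin n) → k) : Ideal (ModelRing n k) :=
  Ideal.span {s | ∃ (ι : Type) (_ : Fintype ι) (_ : DecidableEq ι)
    (x : Ten n (k × ModelRing n k) ι) (φ : ι → Fin n), x ∈ (pairTF m).sp ι ∧
      (∀ y ∈ (pairTF m).sp ι, (pairT x y).1 = 0) ∧ s = (x φ).2}

lemma exists_coloring (d : Multiset (Fin n)) :
    ∃ φ : Fin (Multiset.card d) → Fin n, Finset.univ.val.map φ = d := by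
  induction d using Quotient.inductionOn with
  | h l => exact ⟨l.get, Fin.univ_val_map l.get |>.trans (by simp)⟩

lemma actT_smul_add {Q : Type} [CommRing Q] [Algebra k Q] (g : Fin n → Fin n → Q) (c : k)
    (x y : Ten n Q ι) : actT g (c • x + y) = c • actT g x + actT g y := by
  funext φ
  simp [actT, mul_add, Finset.sum_add_distrib, Finset.smul_sum]

/-- The action of a matrix on tensors, as a linear map. -/
def actL (k : Type) [Field k] {Q : Type} [CommRing Q] [Algebra k Q] (g : Fin n → Fin n → Q) :
    Ten n Q ι →ₗ[k] Ten n Q ι where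
  toFun := actT g
  map_add' x y := by simpa using actT_smul_add g (1 : k) x y
  map_smul' c x := by
    have h0 : actT g (0 : Ten n Q ι) = 0 := by
      funext φ
      simp [actT]
    simpa [h0] using actT_smul_add g c x 0

lemma mk_pol (J : Ideal (Mat n K)) (a : Ten n K ι) (φ : ι → Fin n) :
    Ideal.Quotient.mk J (pol a φ) = actT (fun i j => Ideal.Quotient.mk J (X (i, j)))
      (mapT (Algebra.ofId K (Mat n K ⧸ J)) a) φ := by
  rw [pol_apply, map_sum]
  refine Finset.sum_congr rfl fun ψ _ => ?_
  rw [smul_eq_C_mul, map_mul, mon, map_prod, mul_comm]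
  rfl

lemma exists_functional (A : TF n K K) (hA : A.Nondeg) :
    ∃ ℓ : (Mat n K ⧸ A.fixIdeal) →ₗ[K] K, ∀ p, ℓ (Ideal.Quotient.mk _ p) = hA.haar p :=
  ⟨(A.fixIdeal.restrictScalars K).liftQ hA.haar fun _ hp => hA.haar_fixIdeal hp, fun _ => rfl⟩

lemma span_snd_pairTF (m : Multiset (Fin n) → k) (r : ModelRing n k) :
    r ∈ Submodule.span k {s | ∃ (κ : Type) (_ : Fintype κ) (_ : DecidableEq κ)
      (b : Ten n (k × ModelRing n k) κ) (θ : κ → Fin n), b ∈ (pairTF m).sp κ ∧ s = (b θ).2} := by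
  have hone : (1 : ModelRing n k) ∈ {s | ∃ (κ : Type) (_ : Fintype κ) (_ : DecidableEq κ)
      (b : Ten n (k × ModelRing n k) κ) (θ : κ → Fin n), b ∈ (pairTF m).sp κ ∧ s = (b θ).2} :=
    ⟨Empty, inferInstance, inferInstance, _, fun i => i.elim, (pairTF m).one_mem, rfl⟩
  induction r using MvPolynomial.induction_on with
  | C a =>
    have := Submodule.smul_mem _ a (Submodule.subset_span (R := k) hone)
    rwa [smul_eq_C_mul, mul_one] at this
  | add p q hp hq => exact Submodule.add_mem _ hp hq
  | mul_X p d hp =>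
    obtain ⟨φ, hφ⟩ := exists_coloring d
    refine Submodule.span_induction (p := fun p _ => p * X d ∈ _) ?_ ?_ ?_ ?_ hp
    · rintro _ ⟨κ, _, _, b, θ, hb, rfl⟩
      refine Submodule.subset_span ⟨κ ⊕ Fin (Multiset.card d), inferInstance, inferInstance, _,
        Sum.elim θ φ, (pairTF m).prodT_mem hb (Submodule.subset_span
          (Gen_basic (pairModel m) (Set.mem_univ _))), ?_⟩
      simp [prodT, hφ, pairModel]
    · simp
    · intro x y _ _ hx hy
      rw [add_mul]
      exact Submodule.add_mem _ hx hy
    · intro a x _ hx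
      rw [smul_mul_assoc]
      exact Submodule.smul_mem _ _ hx

lemma radIdeal_ne_top [CharZero k] (m : Multiset (Fin n) → k) : radIdeal m ≠ ⊤ := by
  let T := matchTF n k k
  have hT : T.Nondeg := matchTF_nondeg n k
  obtain ⟨ℓ, hℓ⟩ := exists_functional T hT
  let Q := Mat n k ⧸ T.fixIdeal
  obtain ⟨m', hm'⟩ := exists_actsTo T.genericMat (fun d => algebraMap k Q (m d))
  let Ψ : ModelRing n k →ₐ[k] Q := aeval m'
  have hΨ : ∀ (ι : Type) [Fintype ι] [DecidableEq ι] (z : Ten n (k × ModelRing n k) ι),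
      z ∈ (pairTF m).sp ι → mapT (Ψ.comp (AlgHom.snd k k (ModelRing n k))) z =
        actT T.genericMat (mapT (Algebra.ofId k Q) (mapT (AlgHom.fst k k (ModelRing n k)) z)) := by
    intro ι _ _ z hz
    have : Submodule.span k (Gen (pairModel m) Set.univ ι) ≤ LinearMap.eqLocus
        (mapT (Ψ.comp (AlgHom.snd k k (ModelRing n k))))
        (actL k T.genericMat ∘ₗ mapT (Algebra.ofId k Q) ∘ₗ
          mapT (AlgHom.fst k k (ModelRing n k))) := by
      rw [Submodule.span_le]
      rintro _ ⟨V, H, E, _, _, _, _, _, p, q, hq, -, rfl⟩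
      have h1 := diagram_actsTo p q hq T.genericMat_row (orthogonal_col T.genericMat_row) hm'
      have h2 : mapT (Ψ.comp (AlgHom.snd k k (ModelRing n k))) (diagram (pairModel m) p q) =
          diagram m' p q := by
        funext φ
        simp [diagram, pairModel, apply_ite Prod.snd, apply_ite Ψ, Prod.snd_prod, Ψ]
      have h3 : mapT (Algebra.ofId k Q) (mapT (AlgHom.fst k k (ModelRing n k))
          (diagram (pairModel m) p q)) = diagram (fun d => algebraMap k Q (m d)) p q := by
        funext φ
        simp [diagram, pairModel, apply_ite Prod.fst, apply_ite (algebraMap k Q),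
          Algebra.ofId_apply, Prod.fst_prod]
      exact h2.trans (h1.trans (congrArg (actT T.genericMat) h3.symm))
    exact this hz
  have hker : ∀ s ∈ radIdeal m, ℓ (Ψ s) = 0 := by
    intro s hs
    refine Submodule.span_induction (p := fun s _ => ∀ r, ℓ (Ψ (s * r)) = 0) ?_ (by simp)
      (fun x y _ _ hx hy r => by rw [add_mul, map_add, map_add, hx, hy, add_zero])
      (fun c x _ hx r => by rw [smul_eq_mul, mul_comm c, mul_assoc, hx]) hs 1 |> fun h => by
        rwa [mul_one] at h
    rintro _ ⟨ι, _, _, x, φ, hx, hxy, rfl⟩ r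
    have hr := span_snd_pairTF m r
    refine Submodule.span_induction (p := fun r _ => ℓ (Ψ ((x φ).2 * r)) = 0) ?_ (by simp)
      (fun x y _ _ hx hy => by rw [mul_add, map_add, map_add, hx, hy, add_zero])
      (fun c x _ hx => by rw [mul_smul_comm, map_smul, map_smul, hx, smul_zero]) hr
    rintro _ ⟨κ, _, _, b, θ, hb, rfl⟩
    have hz := (pairTF m).prodT_mem hx hb
    have h1 := congrFun (hΨ _ _ hz) (Sum.elim φ θ)
    have h2 : (mapT (Ψ.comp (AlgHom.snd k k (ModelRing n k))) (prodT x b)) (Sum.elim φ θ) =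
        Ψ ((x φ).2 * (b θ).2) := by
      simp [prodT]
    have h3 := mk_pol T.fixIdeal (mapT (AlgHom.fst k k (ModelRing n k)) (prodT x b)) (Sum.elim φ θ)
    rw [← h2, h1]
    refine Eq.trans (congrArg ℓ h3.symm) ?_
    rw [hℓ, hT.haar_pol]
    suffices h : hT.proj (mapT (AlgHom.fst k k (ModelRing n k)) (prodT x b)) = 0 by
      rw [h]
      rfl
    refine hT.proj_eq (Submodule.zero_mem _) fun t ht => ?_
    rw [← pairL_apply (k := k), map_zero, LinearMap.zero_apply, mapT_prodT, pairT_prodT]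
    have ht' : t ∈ Submodule.span k (Gen
        (fun d => AlgHom.fst k k (ModelRing n k) (pairModel m d)) ∅ (ι ⊕ κ)) := by
      have : t ∈ (matchTF n k k).sp (ι ⊕ κ) := ht
      rw [matchTF_eq (fun d => AlgHom.fst k k (ModelRing n k) (pairModel m d))] at this
      exact this
    rw [← map_span_Gen] at ht'
    obtain ⟨t', ht', rfl⟩ := ht'
    rw [← mapT_contractT, pairT_mapT]
    exact (hxy _ ((pairTF m).contractT_mem
      (Submodule.span_mono (Gen_mono _ (Set.empty_subset _)) ht') hb)).symm
  intro htop
  have h1 := hker 1 (htop ▸ Submodule.mem_top)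
  rw [map_one] at h1
  have h2 := hℓ 1
  rw [map_one, h1, hT.haar_one] at h2
  exact zero_ne_one h2

section Points

variable [Algebra k K] {m : Multiset (Fin n) → k} {ev : ModelRing n k →ₐ[k] K}

lemma ev_eq_zero_of_perp (hev : radIdeal m ≤ RingHom.ker ev) {x : Ten n (k × ModelRing n k) ι}
    (hx : x ∈ (pairTF m).sp ι) (h : ∀ y ∈ (pairTF m).sp ι, (pairT x y).1 = 0) (φ : ι → Fin n) :
    ev (x φ).2 = 0 :=
  hev (Ideal.subset_span ⟨ι, inferInstance, inferInstance, x, φ, hx, h, rfl⟩)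

lemma ev_closed [IsEmpty ι] (hev : radIdeal m ≤ RingHom.ker ev)
    {x : Ten n (k × ModelRing n k) ι} (hx : x ∈ (pairTF m).sp ι) (φ : ι → Fin n) :
    ev (x φ).2 = algebraMap k K (x φ).1 := by
  have h := ev_eq_zero_of_perp hev (Submodule.sub_mem _ hx
    (Submodule.smul_mem _ (x φ).1 ((pairTF m).one_mem (ι := ι)))) (fun y _ => by
      rw [pairT]
      simp only [Prod.fst_sum]
      refine Finset.sum_eq_zero fun ψ _ => ?_
      rw [Subsingleton.elim ψ φ]
      simp) φ
  simp only [Pi.sub_apply, Pi.smul_apply, Prod.snd_sub, map_sub, Prod.smul_snd, map_smul,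
    Prod.snd_one, map_one, sub_eq_zero] at h
  rw [h, Algebra.smul_def, mul_one]

lemma nondeg_of_point (hev : radIdeal m ≤ RingHom.ker ev) :
    (spanTF K (fun d => ev (X d)) Set.univ : TF n K K).Nondeg := by
  refine nondeg_baseChange (k := k) (pairModel m) Set.univ (AlgHom.fst k k (ModelRing n k))
    (ev.comp (AlgHom.snd k k (ModelRing n k))) ?_ ?_
  · intro ι _ _ x y hx hy
    exact ev_closed hev ((pairTF m).pairT_mem (Submodule.subset_span hx)
      (Submodule.subset_span hy)) (fun i => i.elim)
  · intro ι _ _ x hx hxy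
    funext φ
    refine ev_eq_zero_of_perp hev hx (fun y hy => ?_) φ
    have : Submodule.span k (Gen (pairModel m) Set.univ ι) ≤
        LinearMap.ker ((AlgHom.fst k k (ModelRing n k)).toLinearMap ∘ₗ pairL k x) :=
      Submodule.span_le.2 hxy
    exact this hy

end Points

end Universal

noncomputable section Finiteness

set_option linter.unusedSectionVars false

variable {n : ℕ} {K : Type} [Field K]
variable {ι κ : Type} [Fintype ι] [Fintype κ] [DecidableEq ι] [DecidableEq κ]

lemma pairT_basT (ψ : ι → Fin n) (y : Ten n K ι) : pairT (basT K ψ) y = y ψ := by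
  simp [pairT, basT, Pi.single_apply]

lemma pairT_idT {R : Type} [CommRing R] (x : Ten n R (ι ⊕ ι)) :
    pairT x (idT n R ι) = ∑ φ, x (Sum.elim φ φ) := by
  rw [pairT, sum_elim_coloring]
  refine Finset.sum_congr rfl fun φ _ => ?_
  rw [Finset.sum_eq_single φ]
  · simp [idT]
  · intro b _ hb
    have : ¬ (φ = b) := fun h => hb h.symm
    exact (congrArg _ (if_neg this)).trans (mul_zero _)
  · simp

lemma TF.Nondeg.pairT_proj_right {A : TF n K K} (hA : A.Nondeg) (x y : Ten n K ι) :
    pairT (hA.proj x) y = pairT x (hA.proj y) := by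
  rw [pairT_comm, ← hA.pairT_proj y (hA.proj_mem x), pairT_comm, hA.pairT_proj x (hA.proj_mem y)]

/-- The span of the polynomials given by the tensors of a family. -/
def TF.polSpan (B : TF n K K) : Submodule K (Mat n K) :=
  Submodule.span K {p | ∃ (ι : Type) (_ : Fintype ι) (_ : DecidableEq ι) (a : Ten n K ι)
    (φ : ι → Fin n), a ∈ B.sp ι ∧ p = pol a φ}

lemma TF.pol_mem_polSpan (B : TF n K K) {a : Ten n K ι} (ha : a ∈ B.sp ι) (φ : ι → Fin n) :
    pol a φ ∈ B.polSpan :=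
  Submodule.subset_span ⟨ι, inferInstance, inferInstance, a, φ, ha, rfl⟩

lemma TF.mul_mem_polSpan (B : TF n K K) {p q : Mat n K} (hp : p ∈ B.polSpan)
    (hq : q ∈ B.polSpan) : p * q ∈ B.polSpan := by
  refine Submodule.span_induction₂ (p := fun p q _ _ => p * q ∈ B.polSpan) ?_ ?_ ?_ ?_ ?_ ?_ ?_
    hp hq
  · rintro _ _ ⟨ι, _, _, a, φ, ha, rfl⟩ ⟨κ, _, _, b, θ, hb, rfl⟩
    rw [← pol_prodT]
    exact B.pol_mem_polSpan (B.prodT_mem ha hb) _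
  · simp
  · simp
  · intro x y z _ _ _ h1 h2
    rw [add_mul]
    exact Submodule.add_mem _ h1 h2
  · intro x y z _ _ _ h1 h2
    rw [mul_add]
    exact Submodule.add_mem _ h1 h2
  · intro r x y _ _ h
    rw [smul_mul_assoc]
    exact Submodule.smul_mem _ _ h
  · intro r x y _ _ h
    rw [mul_smul_comm]
    exact Submodule.smul_mem _ _ h

lemma TF.Nondeg.haar_mon_mul_mem {T B : TF n K K} (hT : T.Nondeg)
    (hTB : ∀ (ι : Type) [Fintype ι], T.sp ι ≤ B.sp ι) (φ : ι → Fin n) {p : Mat n K}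
    (hp : p ∈ B.polSpan) : (fun χ => hT.haar (mon K φ χ * p)) ∈ B.sp ι := by
  refine Submodule.span_induction (p := fun p _ => (fun χ => hT.haar (mon K φ χ * p)) ∈ B.sp ι)
    ?_ ?_ ?_ ?_ hp
  · rintro _ ⟨κ, _, _, a, θ, ha, rfl⟩
    convert B.contractT_mem (hTB _ (hT.proj_mem (basT K (Sum.elim φ θ)))) ha using 1
    funext χ
    rw [← pol_basT, ← pol_prodT, hT.haar_pol, ← pairT_basT (Sum.elim φ θ) (hT.proj _),
      ← hT.pairT_proj_right, pairT_comm, pairT_prodT, pairT_basT]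
  · convert Submodule.zero_mem (B.sp ι) using 1
    funext χ
    simp
  · intro x y _ _ hx hy
    convert Submodule.add_mem _ hx hy using 1
    funext χ
    simp [mul_add]
  · intro c x _ hx
    convert Submodule.smul_mem _ c hx using 1
    funext χ
    simp

lemma TF.Nondeg.sum_haar_mon_mul_pol {T : TF n K K} (hT : T.Nondeg) (b : Ten n K ι)
    (χ : ι → Fin n) : ∑ φ, hT.haar (mon K φ χ * pol b φ) = b χ := by
  have h : ∀ ψ, ∑ φ, hT.haar (mon K φ χ * mon K φ ψ) = if χ = ψ then 1 else 0 := by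
    intro ψ
    simp only [← mon_elim, hT.haar_mon]
    rw [← pairT_idT, hT.pairT_proj _ T.idT_mem, pairT_basT]
    exact if_congr Iff.rfl rfl rfl
  simp only [pol_apply, Finset.mul_sum, map_sum, mul_smul_comm, map_smul]
  rw [Finset.sum_comm]
  simp only [← Finset.smul_sum, h]
  simp

lemma TF.Nondeg.mem_of_pol_mem {T B : TF n K K} (hT : T.Nondeg)
    (hTB : ∀ (ι : Type) [Fintype ι], T.sp ι ≤ B.sp ι) {b : Ten n K ι}
    (hb : ∀ φ, pol b φ ∈ B.polSpan) : b ∈ B.sp ι := by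
  have : b = ∑ φ, fun χ => hT.haar (mon K φ χ * pol b φ) := by
    funext χ
    rw [Finset.sum_apply, hT.sum_haar_mon_mul_pol]
  rw [this]
  exact Submodule.sum_mem _ fun φ _ => hT.haar_mon_mul_mem hTB φ (hb φ)

lemma exists_bound_of_mem_Gen {R : Type} [CommRing R] (m : Multiset (Fin n) → R) {x : Ten n R ι}
    (hx : x ∈ Gen m Set.univ ι) : ∃ e, x ∈ Gen m (Set.Iic e) ι := by
  obtain ⟨V, H, E, _, _, _, _, _, p, q, hq, -, rfl⟩ := hx
  refine ⟨Fintype.card H, V, H, E, inferInstance, inferInstance, inferInstance, inferInstance,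
    inferInstance, p, q, hq, fun v => ?_, rfl⟩
  rw [Set.mem_Iic, ← Finset.card_filter]
  exact Finset.card_filter_le _ _

/-- The ideal generated by the non-constant diagrams with vertices of degree at most `e`. -/
def degIdeal (m : Multiset (Fin n) → K) (e : ℕ) : Ideal (Mat n K) :=
  Ideal.span {p | ∃ (ι : Type) (_ : Fintype ι) (_ : DecidableEq ι) (a : Ten n K ι)
    (φ : ι → Fin n), Nonempty ι ∧ a ∈ Gen m (Set.Iic e) ι ∧ p = pol a φ}

lemma degIdeal_mono (m : Multiset (Fin n) → K) : Monotone (degIdeal m) := by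
  intro e e' h
  refine Ideal.span_mono ?_
  rintro _ ⟨ι, _, _, a, φ, hι, ha, rfl⟩
  exact ⟨ι, inferInstance, inferInstance, a, φ, hι, Gen_mono _ (Set.Iic_subset_Iic.2 h) ha, rfl⟩

lemma exists_degIdeal (m : Multiset (Fin n) → K) :
    ∃ e₀, ∀ (ι : Type) [Fintype ι] [DecidableEq ι] [Nonempty ι] (b : Ten n K ι) (φ : ι → Fin n),
      b ∈ (spanTF K m Set.univ : TF n K K).sp ι → pol b φ ∈ degIdeal m e₀ := by
  obtain ⟨e₀, h⟩ := monotone_stabilizes_iff_noetherian.2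
    (inferInstanceAs (IsNoetherian (Mat n K) (Mat n K))) ⟨degIdeal m, degIdeal_mono m⟩
  refine ⟨e₀, fun ι _ _ _ b φ hb => ?_⟩
  refine Submodule.span_induction (p := fun b _ => pol b φ ∈ degIdeal m e₀) ?_ ?_ ?_ ?_ hb
  · intro x hx
    obtain ⟨e, he⟩ := exists_bound_of_mem_Gen m hx
    have h1 : pol x φ ∈ degIdeal m e :=
      Ideal.subset_span ⟨ι, inferInstance, inferInstance, x, φ, inferInstance, he, rfl⟩
    have h2 := degIdeal_mono m (le_max_right e₀ e) h1
    have h3 : degIdeal m e₀ = degIdeal m (max e₀ e) := h _ (le_max_left _ _)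
    rwa [h3]
  · simp
  · intro x y _ _ hx hy
    rw [map_add]
    exact Ideal.add_mem _ hx hy
  · intro c x _ hx
    rw [map_smul, Pi.smul_apply, smul_eq_C_mul]
    exact Ideal.mul_mem_left _ _ hx

lemma isHomogeneous_mon (φ ψ : ι → Fin n) : (mon K φ ψ).IsHomogeneous (Fintype.card ι) := by
  have := IsHomogeneous.prod Finset.univ (fun s => (X (φ s, ψ s) : Mat n K)) (fun _ => 1)
    fun s _ => isHomogeneous_X _ _
  simpa [mon] using this

lemma isHomogeneous_pol (a : Ten n K ι) (φ : ι → Fin n) :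
    (pol a φ).IsHomogeneous (Fintype.card ι) := by
  rw [pol_apply]
  refine IsHomogeneous.sum _ _ _ fun ψ _ => ?_
  rw [smul_eq_C_mul]
  exact (isHomogeneous_mon φ ψ).C_mul _

lemma homogeneousComponent_eq_ite {σ : Type} {p : MvPolynomial σ K} {d : ℕ}
    (hp : p.IsHomogeneous d) (N : ℕ) :
    homogeneousComponent N p = if d = N then p else 0 := by
  rw [homogeneousComponent_of_mem hp]
  simp [eq_comm]

lemma pol_mem_polSpan_of_card (m : Multiset (Fin n) → K)
    (hA : (spanTF K m Set.univ : TF n K K).Nondeg) {e₀ : ℕ}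
    (he₀ : ∀ (ι : Type) [Fintype ι] [DecidableEq ι] [Nonempty ι] (b : Ten n K ι) (φ : ι → Fin n),
      b ∈ (spanTF K m Set.univ : TF n K K).sp ι → pol b φ ∈ degIdeal m e₀) (N : ℕ) :
    ∀ (ι : Type) [Fintype ι] [DecidableEq ι], Fintype.card ι = N → ∀ (b : Ten n K ι) (φ : ι → Fin n),
      b ∈ (spanTF K m Set.univ : TF n K K).sp ι →
        pol b φ ∈ (spanTF K m (Set.Iic e₀) : TF n K K).polSpan := by
  induction N using Nat.strong_induction_on with
  | _ N ih =>
  intro ι _ _ hN b φ hb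
  rcases isEmpty_or_nonempty ι with hι | hι
  · have : b = b φ • (fun _ => 1) := by
      funext ψ
      rw [Subsingleton.elim ψ φ]
      simp
    rw [this]
    exact TF.pol_mem_polSpan _ (Submodule.smul_mem _ _ (TF.one_mem _)) φ
  have key : ∀ p ∈ degIdeal m e₀, hA.reynolds (homogeneousComponent N p) ∈
      (spanTF K m (Set.Iic e₀) : TF n K K).polSpan := by
    intro p hp
    refine Submodule.span_induction (p := fun p _ => ∀ r, hA.reynolds (homogeneousComponent N
      (r * p)) ∈ (spanTF K m (Set.Iic e₀) : TF n K K).polSpan) ?_ (by simp) ?_ ?_ hp 1 |> fun h => by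
        rwa [one_mul] at h
    · rintro _ ⟨κ, _, _, a, θ, hκ, ha, rfl⟩ r
      induction r using MvPolynomial.induction_on' with
      | monomial d c =>
        have h1 : (monomial d c : Mat n K) = c • monomial d 1 := by simp [smul_monomial]
        rw [h1, monomial_eq_mon, smul_mul_assoc, map_smul, map_smul]
        refine Submodule.smul_mem _ _ ?_
        rw [homogeneousComponent_eq_ite ((isHomogeneous_mon _ _).mul (isHomogeneous_pol a θ))]
        split_ifs with hd
        · have ha' : a ∈ (spanTF K m Set.univ : TF n K K).sp κ :=
            Submodule.subset_span (Gen_mono m (Set.subset_univ _) ha)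
          rw [hA.reynolds_mul_pol _ ha', hA.reynolds_mon]
          refine TF.mul_mem_polSpan _ (ih _ ?_ _ rfl _ _ (hA.proj_mem _))
            (TF.pol_mem_polSpan _ (Submodule.subset_span ha) θ)
          have := Fintype.card_pos (α := κ)
          omega
        · simp
      | add p q hp hq =>
        rw [add_mul, map_add, map_add]
        exact Submodule.add_mem _ hp hq
    · intro x y _ _ hx hy r
      rw [mul_add, map_add, map_add]
      exact Submodule.add_mem _ (hx r) (hy r)
    · intro c x _ hx r
      rw [smul_eq_mul, ← mul_assoc]
      exact hx _
  have h := key _ (he₀ ι b φ hb)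
  rwa [homogeneousComponent_eq_ite (isHomogeneous_pol b φ), if_pos hN, hA.reynolds_pol,
    hA.proj_of_mem hb] at h

/-- A nondegenerate vertex model is determined by its restriction to bounded degrees. -/
lemma exists_spanTF_eq [CharZero K] (m : Multiset (Fin n) → K)
    (hA : (spanTF K m Set.univ : TF n K K).Nondeg) : ∃ e₀, ∀ (ι : Type) [Fintype ι],
      (spanTF K m Set.univ : TF n K K).sp ι ≤ (spanTF K m (Set.Iic e₀) : TF n K K).sp ι := by
  obtain ⟨e₀, he₀⟩ := exists_degIdeal m
  refine ⟨e₀, fun ι _ b hb => ?_⟩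
  classical
  refine (matchTF_nondeg n K).mem_of_pol_mem (fun κ _ => ?_) fun φ =>
    pol_mem_polSpan_of_card m hA he₀ _ ι rfl b φ hb
  classical
  exact matchTF_le m _

end Finiteness

noncomputable section Descent

set_option linter.unusedSectionVars false

variable {n : ℕ} {k : Type} [Field k]
variable {ι κ : Type} [Fintype ι] [Fintype κ] [DecidableEq ι] [DecidableEq κ]

lemma finite_multiset_card_le (n e : ℕ) : {d : Multiset (Fin n) | Multiset.card d ≤ e}.Finite := by
  refine (Set.finite_range fun s : Σ j : Fin (e + 1), (Fin j → Fin n) =>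
    (Finset.univ.val.map s.2 : Multiset (Fin n))).subset fun d hd => ?_
  obtain ⟨φ, hφ⟩ := exists_coloring d
  exact ⟨⟨⟨Multiset.card d, Nat.lt_succ_of_le hd⟩, φ⟩, hφ⟩

section Points

variable {K : Type} [Field K] [Algebra k K] {m : Multiset (Fin n) → k}
  {ev : ModelRing n k →ₐ[k] K}

lemma mapT_diagram {V H E : Type} [Fintype V] [Fintype H] [Fintype E] [DecidableEq V]
    [DecidableEq E] (p : H → V) (q : H ⊕ ι → E) :
    mapT (ev.comp (AlgHom.snd k k (ModelRing n k))) (diagram (pairModel m) p q) =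
      diagram (fun d => ev (X d)) p q := by
  funext φ
  simp only [mapT_apply, diagram, map_sum, apply_ite (ev.comp (AlgHom.snd k k (ModelRing n k))),
    map_prod, map_zero]
  rfl

lemma exists_mapT_eq {D : Set ℕ} {x : Ten n K ι} (hx : x ∈ Gen (fun d => ev (X d)) D ι) :
    ∃ z ∈ Gen (pairModel m) D ι, mapT (ev.comp (AlgHom.snd k k (ModelRing n k))) z = x := by
  obtain ⟨V, H, E, _, _, _, _, _, p, q, hq, hp, rfl⟩ := hx
  refine ⟨_, ⟨V, H, E, inferInstance, inferInstance, inferInstance, inferInstance, inferInstance,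
    p, q, hq, hp, rfl⟩, mapT_diagram p q⟩

/-- Pairings of combinations over the big field are, after applying a linear functional,
pairings of combinations over the small field. -/
lemma exists_combination (hev : radIdeal m ≤ RingHom.ker ev) {D : Set ℕ} {w : Ten n K ι}
    (hw : w ∈ (spanTF K (fun d => ev (X d)) D : TF n K K).sp ι) :
    ∀ s : K →ₗ[k] k, ∃ u ∈ (spanTF k (pairModel m) D).sp ι, ∀ y ∈ (pairTF m).sp ι,
      (pairT u y).1 = s (pairT w (mapT (ev.comp (AlgHom.snd k k (ModelRing n k))) y)) := by
  refine Submodule.span_induction (p := fun w _ => ∀ s : K →ₗ[k] k,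
    ∃ u ∈ (spanTF k (pairModel m) D).sp ι, ∀ y ∈ (pairTF m).sp ι,
      (pairT u y).1 = s (pairT w (mapT (ev.comp (AlgHom.snd k k (ModelRing n k))) y)))
    ?_ ?_ ?_ ?_ hw
  · intro x hx s
    obtain ⟨z, hz, rfl⟩ := exists_mapT_eq (m := m) hx
    refine ⟨s 1 • z, Submodule.smul_mem _ _ (Submodule.subset_span hz), fun y hy => ?_⟩
    have h1 : z ∈ (pairTF m).sp ι := Submodule.subset_span (Gen_mono _ (Set.subset_univ _) hz)
    have h2 := ev_closed hev ((pairTF m).pairT_mem h1 hy) (fun i => i.elim)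
    have h3 := pairT_mapT (ev.comp (AlgHom.snd k k (ModelRing n k))) z y
    have h4 : (ev.comp (AlgHom.snd k k (ModelRing n k))) (pairT z y) =
        algebraMap k K (pairT z y).1 := h2
    rw [h3, h4, Algebra.algebraMap_eq_smul_one, map_smul, ← pairL_apply (k := k), map_smul,
      LinearMap.smul_apply, Prod.smul_fst, pairL_apply, smul_eq_mul, smul_eq_mul, mul_comm]
  · intro s
    exact ⟨0, Submodule.zero_mem _, fun y _ => by simp [pairT]⟩
  · intro x y _ _ hx hy s
    obtain ⟨u, hu, hu'⟩ := hx s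
    obtain ⟨v, hv, hv'⟩ := hy s
    refine ⟨u + v, Submodule.add_mem _ hu hv, fun y hy => ?_⟩
    rw [← pairL_apply (k := k), ← pairL_apply (k := K), map_add, map_add, LinearMap.add_apply,
      LinearMap.add_apply, map_add, Prod.fst_add, pairL_apply, pairL_apply, pairL_apply,
      pairL_apply, hu' y hy, hv' y hy]
  · intro c x _ hx s
    obtain ⟨u, hu, hu'⟩ := hx (s ∘ₗ LinearMap.mulLeft k c)
    refine ⟨u, hu, fun y hy => ?_⟩
    rw [hu' y hy, ← pairL_apply (k := K) (c • x), map_smul, LinearMap.smul_apply, pairL_apply]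
    rfl

lemma ev_snd_mem_adjoin {D : Set ℕ} {u : Ten n (k × ModelRing n k) ι}
    (hu : u ∈ (spanTF k (pairModel m) D).sp ι) (φ : ι → Fin n) :
    ev (u φ).2 ∈ Algebra.adjoin k ((fun d => ev (X d)) '' {d | Multiset.card d ∈ D}) := by
  refine Submodule.span_induction (p := fun u _ => ev (u φ).2 ∈
    Algebra.adjoin k ((fun d => ev (X d)) '' {d | Multiset.card d ∈ D})) ?_ ?_ ?_ ?_ hu
  · rintro _ ⟨V, H, E, _, _, _, _, _, p, q, -, hp, rfl⟩
    change mapT (ev.comp (AlgHom.snd k k (ModelRing n k))) (diagram (pairModel m) p q) φ ∈ _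
    rw [mapT_diagram]
    refine Subalgebra.sum_mem _ fun ψ _ => ?_
    split_ifs
    · refine Subalgebra.prod_mem _ fun v _ => Algebra.subset_adjoin ⟨_, ?_, rfl⟩
      have : Multiset.card (colorsAt p (fun x => ψ (q (Sum.inl x))) v) =
          ∑ x, if p x = v then 1 else 0 := by
        simp [colorsAt, Finset.sum_ite]
      rw [Set.mem_ofPred_eq, this]
      exact hp v
    · exact Subalgebra.zero_mem _
  · simp
  · intro x y _ _ hx hy
    rw [Pi.add_apply, Prod.snd_add, map_add]
    exact Subalgebra.add_mem _ hx hy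
  · intro c x _ hx
    rw [Pi.smul_apply, Prod.smul_snd, map_smul]
    exact Subalgebra.smul_mem _ hx c

lemma ev_X_mem_adjoin (hev : radIdeal m ≤ RingHom.ker ev) {D : Set ℕ}
    (hD : ∀ (ι : Type) [Fintype ι], (spanTF K (fun d => ev (X d)) Set.univ : TF n K K).sp ι ≤
      (spanTF K (fun d => ev (X d)) D : TF n K K).sp ι) (d : Multiset (Fin n)) :
    ev (X d) ∈ Algebra.adjoin k ((fun d => ev (X d)) '' {d | Multiset.card d ∈ D}) := by
  obtain ⟨φ, hφ⟩ := exists_coloring d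
  generalize Multiset.card d = N at φ hφ
  subst hφ
  let ι := Fin N
  obtain ⟨s, hs⟩ := LinearMap.exists_leftInverse_of_injective (Algebra.linearMap k K)
    (LinearMap.ker_eq_bot.2 (FaithfulSMul.algebraMap_injective k K))
  let z : Ten n (k × ModelRing n k) ι := fun φ => pairModel m (Finset.univ.val.map φ)
  have hz : z ∈ (pairTF m).sp ι :=
    Submodule.subset_span (Gen_basic (pairModel m) (Set.mem_univ _))
  obtain ⟨u, hu, hu'⟩ := exists_combination hev (hD ι (Submodule.subset_span
    (Gen_basic (fun d => ev (X d)) (Set.mem_univ (Fintype.card ι))))) s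
  have huz : u ∈ (pairTF m).sp ι := Submodule.span_mono (Gen_mono _ (Set.subset_univ _)) hu
  have h := ev_eq_zero_of_perp hev (Submodule.sub_mem _ hz huz) (fun y hy => by
    have h1 := ev_closed hev ((pairTF m).pairT_mem hz hy) (fun i => i.elim)
    have h2 := pairT_mapT (ev.comp (AlgHom.snd k k (ModelRing n k))) z y
    rw [← pairL_apply (k := k), map_sub, LinearMap.sub_apply, Prod.fst_sub, pairL_apply,
      pairL_apply, hu' y hy, sub_eq_zero]
    refine Eq.trans ?_ (congrArg s (h2.trans h1)).symm
    exact (LinearMap.congr_fun hs _).symm) φ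
  rw [Pi.sub_apply, Prod.snd_sub, map_sub, sub_eq_zero] at h
  change ev (z φ).2 ∈ _
  rw [h]
  exact ev_snd_mem_adjoin hu φ

lemma bijective_algebraMap_of_point [IsAlgClosed k] [CharZero k]
    (hev : radIdeal m ≤ RingHom.ker ev) (hs : Function.Surjective ev) :
    Function.Bijective (algebraMap k K) := by
  have : CharZero K := charZero_of_injective_algebraMap (FaithfulSMul.algebraMap_injective k K)
  obtain ⟨e₀, he₀⟩ := exists_spanTF_eq (fun d => ev (X d)) (nondeg_of_point hev)
  have htop : Algebra.adjoin k ((fun d => ev (X d)) '' {d | Multiset.card d ∈ Set.Iic e₀}) = ⊤ := by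
    rw [eq_top_iff]
    rintro x -
    obtain ⟨r, rfl⟩ := hs x
    induction r using MvPolynomial.induction_on with
    | C a =>
      rw [← algebraMap_eq, AlgHom.commutes]
      exact Subalgebra.algebraMap_mem _ _
    | add p q hp hq =>
      rw [map_add]
      exact Subalgebra.add_mem _ hp hq
    | mul_X p d hp =>
      rw [map_mul]
      exact Subalgebra.mul_mem _ hp (ev_X_mem_adjoin hev he₀ d)
  have : Algebra.FiniteType k K :=
    ⟨Subalgebra.fg_def.2 ⟨_, (finite_multiset_card_le n e₀).image _, htop⟩⟩
  have : Module.Finite k K := finite_of_finite_type_of_isJacobsonRing k K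
  exact IsAlgClosed.algebraMap_bijective_of_isIntegral

end Points

lemma exists_point [IsAlgClosed k] [CharZero k] (m : Multiset (Fin n) → k) :
    ∃ ev : ModelRing n k →ₐ[k] k, radIdeal m ≤ RingHom.ker ev := by
  obtain ⟨M, hM, hle⟩ := Ideal.exists_le_maximal _ (radIdeal_ne_top m)
  let K := ModelRing n k ⧸ M
  let _ : Field K := Ideal.Quotient.field M
  have hev : radIdeal m ≤ RingHom.ker (Ideal.Quotient.mkₐ k M) :=
    fun r hr => Ideal.Quotient.eq_zero_iff_mem.2 (hle hr)
  let e := AlgEquiv.ofBijective (Algebra.ofId k K)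
    (bijective_algebraMap_of_point hev (Ideal.Quotient.mkₐ_surjective k M))
  refine ⟨(e.symm : K →ₐ[k] k).comp (Ideal.Quotient.mkₐ k M), fun r hr => ?_⟩
  have := hev hr
  rw [RingHom.mem_ker] at this ⊢
  rw [AlgHom.comp_apply, this, map_zero]

/-- Every vertex model has the same closed diagrams as one whose tensor algebra is
nondegenerate. -/
lemma exists_nondeg_model [IsAlgClosed k] [CharZero k] (m : Multiset (Fin n) → k) :
    ∃ m' : Multiset (Fin n) → k, (spanTF k m' Set.univ : TF n k k).Nondeg ∧
      ∀ (V H E ι : Type) [Fintype V] [Fintype H] [Fintype E] [DecidableEq V] [DecidableEq E]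
        [Fintype ι] [DecidableEq ι] [IsEmpty ι] (p : H → V) (q : H ⊕ ι → E), Paired q →
        diagram m' p q = diagram m p q := by
  obtain ⟨ev, hev⟩ := exists_point m
  refine ⟨fun d => ev (X d), nondeg_of_point hev, ?_⟩
  intro V H E ι _ _ _ _ _ _ _ _ p q hq
  have hz : diagram (pairModel m) p q ∈ (pairTF m).sp ι := Submodule.subset_span
    ⟨V, H, E, inferInstance, inferInstance, inferInstance, inferInstance, inferInstance, p, q, hq,
      fun _ => Set.mem_univ _, rfl⟩
  funext φ
  have h := ev_closed hev hz φ
  simpa [diagram, pairModel, apply_ite Prod.fst, apply_ite Prod.snd, apply_ite ev, Prod.fst_sum,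
    Prod.snd_sum, Prod.fst_prod, Prod.snd_prod] using h

end Descent

noncomputable section Reduced

set_option linter.unusedSectionVars false

variable {n : ℕ} {K : Type} [Field K]
variable {ι κ : Type} [Fintype ι] [Fintype κ] [DecidableEq ι] [DecidableEq κ]

lemma derivation_prod {R : Type} [CommRing R] [Algebra K R] (D : Derivation K R R) (S : Finset ι)
    (f : ι → R) :
    D (∏ t ∈ S, f t) = ∑ s ∈ S, ∏ t ∈ S, if t = s then D (f t) else f t := by
  induction S using Finset.induction_on with
  | empty => simp
  | insert a S ha ih =>
    rw [Finset.prod_insert ha, Derivation.leibniz, ih, Finset.sum_insert ha, Finset.prod_insert ha,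
      if_pos rfl, add_comm, smul_eq_mul, smul_eq_mul, mul_comm, Finset.mul_sum]
    congr 1
    · congr 1
      refine Finset.prod_congr rfl fun t ht => ?_
      rw [if_neg]
      rintro rfl
      exact ha ht
    · refine Finset.sum_congr rfl fun s hs => ?_
      rw [Finset.prod_insert ha, if_neg]
      rintro rfl
      exact ha hs

/-- Evaluation at the identity matrix. -/
def evOne (n : ℕ) (K : Type) [Field K] : Mat n K →ₐ[K] K :=
  aeval fun p => if p.1 = p.2 then 1 else 0

@[simp] lemma evOne_X (p : Fin n × Fin n) : evOne n K (X p) = if p.1 = p.2 then 1 else 0 := by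
  simp [evOne]

@[simp] lemma evOne_C (c : K) : evOne n K (C c) = c := by
  simp [evOne]

/-- The entries of the generic matrix minus the identity matrix. -/
def dX (K : Type) [Field K] (p : Fin n × Fin n) : Mat n K := X p - C (if p.1 = p.2 then 1 else 0)

/-- The ideal of the identity matrix. -/
def oneIdeal (n : ℕ) (K : Type) [Field K] : Ideal (Mat n K) := Ideal.span (Set.range (dX K))

lemma dX_mem (p : Fin n × Fin n) : dX K p ∈ oneIdeal n K := Ideal.subset_span ⟨p, rfl⟩

lemma sub_evOne_mem (q : Mat n K) : q - C (evOne n K q) ∈ oneIdeal n K := by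
  induction q using MvPolynomial.induction_on with
  | C a => simp
  | add p q hp hq =>
    rw [map_add, map_add, add_sub_add_comm]
    exact Ideal.add_mem _ hp hq
  | mul_X q p hq =>
    have : q * X p - C (evOne n K (q * X p)) =
        X p * (q - C (evOne n K q)) + C (evOne n K q) * dX K p := by
      rw [map_mul, map_mul, evOne_X, dX]
      ring
    rw [this]
    exact Ideal.add_mem _ (Ideal.mul_mem_left _ _ hq) (Ideal.mul_mem_left _ _ (dX_mem p))

lemma oneIdeal_eq_ker : oneIdeal n K = RingHom.ker (evOne n K) := by
  refine le_antisymm (Ideal.span_le.2 ?_) fun q hq => ?_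
  · rintro _ ⟨p, rfl⟩
    simp [dX]
  · have := sub_evOne_mem q
    rwa [(RingHom.mem_ker).1 hq, C_0, sub_zero] at this

/-- The differential at the identity. -/
def dOne : Mat n K →ₗ[K] (Fin n × Fin n → K) :=
  LinearMap.pi fun p => (evOne n K).toLinearMap ∘ₗ (pderiv p).toLinearMap

lemma dOne_apply (q : Mat n K) (p : Fin n × Fin n) : dOne q p = evOne n K (pderiv p q) := rfl

lemma taylor_mem {u : Mat n K} (hu : u ∈ oneIdeal n K) :
    u - ∑ p, C (dOne u p) * dX K p ∈ oneIdeal n K ^ 2 := by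
  refine Submodule.span_induction (p := fun u _ => u - ∑ p, C (dOne u p) * dX K p ∈
    oneIdeal n K ^ 2) ?_ (by simp) ?_ ?_ hu
  · rintro _ ⟨p, rfl⟩
    have : ∀ r, dOne (dX K p) r = if p = r then 1 else 0 := by
      intro r
      rw [dOne_apply, dX, map_sub, pderiv_C, sub_zero, pderiv_X]
      by_cases h : p = r
      · subst h
        simp
      · rw [Pi.single_eq_of_ne h, map_zero, if_neg h]
    simp only [this]
    simp
  · intro x y _ _ hx hy
    have : x + y - ∑ p, C (dOne (x + y) p) * dX K p =
        (x - ∑ p, C (dOne x p) * dX K p) + (y - ∑ p, C (dOne y p) * dX K p) := by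
      rw [map_add]
      simp only [Pi.add_apply, map_add, add_mul, Finset.sum_add_distrib]
      ring
    rw [this]
    exact Ideal.add_mem _ hx hy
  · intro r x hx hx'
    have hx0 : evOne n K x = 0 := by
      have hx1 : x ∈ oneIdeal n K := hx
      rwa [oneIdeal_eq_ker] at hx1
    have : r • x - ∑ p, C (dOne (r • x) p) * dX K p =
        (r - C (evOne n K r)) * x + C (evOne n K r) * (x - ∑ p, C (dOne x p) * dX K p) := by
      simp only [dOne_apply, smul_eq_mul, Derivation.leibniz, map_add, map_mul, hx0, zero_mul,
        add_zero, mul_assoc, ← Finset.mul_sum]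
      ring
    rw [this]
    refine Ideal.add_mem _ ?_ (Ideal.mul_mem_left _ _ hx')
    rw [pow_two]
    exact Ideal.mul_mem_mul (sub_evOne_mem r) hx

/-- The derivation sending the generic matrix `X` to `X Y`. -/
def lieD (Y : Fin n × Fin n → K) : Derivation K (Mat n K) (Mat n K) :=
  ∑ p : Fin n × Fin n, (∑ c, X (p.1, c) * C (Y (c, p.2)) : Mat n K) • pderiv p

lemma lieD_apply (Y : Fin n × Fin n → K) (q : Mat n K) :
    lieD Y q = ∑ p : Fin n × Fin n, (∑ c, X (p.1, c) * C (Y (c, p.2))) * pderiv p q := by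
  refine (congrFun (map_sum (Derivation.coeFnAddMonoidHom (R := K) (A := Mat n K)
    (M := Mat n K)) _ _) q).trans ?_
  rw [Finset.sum_apply]
  rfl

lemma lieD_X (Y : Fin n × Fin n → K) (p : Fin n × Fin n) :
    lieD Y (X p) = ∑ c, X (p.1, c) * C (Y (c, p.2)) := by
  rw [lieD_apply, Finset.sum_eq_single p]
  · simp
  · intro b _ hb
    rw [pderiv_X_of_ne hb.symm, mul_zero]
  · simp

lemma evOne_lieD (Y : Fin n × Fin n → K) (q : Mat n K) :
    evOne n K (lieD Y q) = ∑ p, dOne q p * Y p := by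
  rw [lieD_apply, map_sum]
  refine Finset.sum_congr rfl fun p _ => ?_
  rw [map_mul, map_sum, dOne_apply, mul_comm]
  simp

lemma lieD_mon (Y : Fin n × Fin n → K) (φ ψ : ι → Fin n) :
    lieD Y (mon K φ ψ) = ∑ χ, mon K φ χ * C (evOne n K (lieD Y (mon K χ ψ))) := by
  have h1 : ∀ s t, (if t = s then lieD Y (X (φ t, ψ t)) else (X (φ t, ψ t) : Mat n K)) =
      ∑ c, X (φ t, c) * C (if t = s then Y (c, ψ t) else if c = ψ t then 1 else 0) := by
    intro s t
    split_ifs with h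
    · rw [lieD_X]
    · rw [Finset.sum_eq_single (ψ t)]
      · simp
      · intro c _ hc
        simp [hc]
      · simp
  have h2 : ∀ χ : ι → Fin n, evOne n K (lieD Y (mon K χ ψ)) =
      ∑ s, ∏ t, if t = s then Y (χ t, ψ t) else if χ t = ψ t then 1 else 0 := by
    intro χ
    rw [mon, derivation_prod, map_sum]
    refine Finset.sum_congr rfl fun s _ => ?_
    rw [map_prod]
    refine Finset.prod_congr rfl fun t _ => ?_
    split_ifs with h h'
    · rw [lieD_X]
      simp
    · simp [h']
    · simp [h']
  simp only [h2, map_sum, map_prod, Finset.mul_sum]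
  rw [mon, derivation_prod, Finset.sum_comm]
  refine Finset.sum_congr rfl fun s _ => ?_
  simp only [h1]
  rw [Finset.prod_univ_sum]
  simp only [Fintype.piFinset_univ, mon, Finset.prod_mul_distrib]

lemma lieD_pol (Y : Fin n × Fin n → K) (a : Ten n K ι) (φ : ι → Fin n) :
    lieD Y (pol a φ) = ∑ χ, mon K φ χ * C (evOne n K (lieD Y (pol a χ))) := by
  simp only [pol_apply, map_sum, Finset.mul_sum]
  rw [Finset.sum_comm]
  refine Finset.sum_congr rfl fun ψ _ => ?_
  simp only [Derivation.map_smul, map_smul]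
  rw [lieD_mon, Finset.smul_sum]
  refine Finset.sum_congr rfl fun χ _ => ?_
  rw [smul_eq_mul, map_mul, smul_eq_C_mul]
  ring

variable (A : TF n K K)

lemma TF.lieD_mem_fixIdeal {Y : Fin n × Fin n → K}
    (hY : ∀ q ∈ A.fixIdeal, ∑ p, dOne q p * Y p = 0) {q : Mat n K} (hq : q ∈ A.fixIdeal) :
    lieD Y q ∈ A.fixIdeal := by
  refine Submodule.span_induction (p := fun q _ => lieD Y q ∈ A.fixIdeal) ?_ (by simp) ?_ ?_ hq
  · rintro _ ⟨ι, _, _, a, φ, ha, rfl⟩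
    rw [map_sub, ← algebraMap_eq, Derivation.map_algebraMap, sub_zero, lieD_pol,
      Finset.sum_eq_zero]
    · exact Ideal.zero_mem _
    · intro χ _
      have h := hY _ (A.pol_sub_mem_fixIdeal ha χ)
      rw [← evOne_lieD, map_sub, ← algebraMap_eq, Derivation.map_algebraMap, sub_zero] at h
      rw [h, map_zero, mul_zero]
  · intro x y _ _ hx hy
    rw [map_add]
    exact Ideal.add_mem _ hx hy
  · intro r x hx hx'
    rw [smul_eq_mul, Derivation.leibniz]
    exact Ideal.add_mem _ (Ideal.mul_mem_left _ _ hx') (Ideal.mul_mem_right _ _ hx)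

lemma derivation_mem_radical {R : Type} [CommRing R] [Algebra K R] [CharZero K]
    {J : Ideal R} (D : Derivation K R R) (hD : ∀ q ∈ J, D q ∈ J) {q : R} (hq : q ∈ J.radical) :
    D q ∈ J.radical := by
  have key : ∀ i l, q ^ (i + 1) * D q ^ l ∈ J → q ^ i * D q ^ (l + 2) ∈ J := by
    intro i l h
    have h1 := Ideal.mul_mem_left _ (D q) (hD _ h)
    have h2 := Ideal.mul_mem_left _ ((l : R) * D (D q)) h
    have h3 : ((i + 1 : ℕ) : R) * (q ^ i * D q ^ (l + 2)) ∈ J := by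
      convert Ideal.sub_mem _ h1 h2 using 1
      rw [Derivation.leibniz, Derivation.leibniz_pow, Derivation.leibniz_pow]
      rcases l with _ | l
      · simp only [smul_eq_mul, nsmul_eq_mul, Nat.add_sub_cancel]
        push_cast
        ring
      · simp only [smul_eq_mul, nsmul_eq_mul, Nat.add_sub_cancel]
        push_cast
        ring
    have h4 : ((i + 1 : ℕ) : K) ≠ 0 := Nat.cast_ne_zero.2 (Nat.succ_ne_zero i)
    have h5 := Ideal.mul_mem_left _ (algebraMap K R ((i + 1 : ℕ) : K)⁻¹) h3
    rwa [← mul_assoc, ← map_natCast (algebraMap K R), ← map_mul, inv_mul_cancel₀ h4, map_one,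
      one_mul] at h5
  obtain ⟨r, hr⟩ := hq
  have : ∀ j, ∀ i l, i = j → q ^ i * D q ^ l ∈ J → ∃ N, D q ^ N ∈ J := by
    intro j
    induction j with
    | zero =>
      rintro i l rfl h
      exact ⟨l, by simpa using h⟩
    | succ j ih =>
      rintro i l rfl h
      exact ih j (l + 2) rfl (key j l h)
  exact this r r 0 rfl (by simpa using hr)

end Reduced

noncomputable section Cartier

set_option linter.unusedSectionVars false

variable {n : ℕ} {K : Type} [Field K]
variable {ι κ : Type} [Fintype ι] [Fintype κ] [DecidableEq ι] [DecidableEq κ]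

lemma exists_projection_matrix {P : Type} [Fintype P] [DecidableEq P] (W : Submodule K (P → K)) :
    ∃ B : P → P → K, (∀ p, B p ∈ W) ∧ ∀ w ∈ W, ∀ r, ∑ p, w p * B p r = w r := by
  obtain ⟨f, hf⟩ := LinearMap.exists_leftInverse_of_injective W.subtype W.ker_subtype
  refine ⟨fun p => f (Pi.single p 1), fun p => (f _).2, fun w hw r => ?_⟩
  have h1 : w = ∑ p, w p • Pi.single p (1 : K) := by
    funext q
    simp [Finset.sum_apply, Pi.single_apply]
  have h2 : (f w : P → K) = w := congrArg Subtype.val (LinearMap.congr_fun hf ⟨w, hw⟩)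
  conv_rhs => rw [← h2, h1]
  simp [Finset.sum_apply]

lemma aeval_pol (g : Fin n → Fin n → K) (a : Ten n K ι) (φ : ι → Fin n) :
    aeval (fun p : Fin n × Fin n => g p.1 p.2) (pol a φ) = actT g a φ := by
  rw [pol_apply, map_sum]
  refine Finset.sum_congr rfl fun ψ _ => ?_
  rw [map_smul, mon, map_prod, smul_eq_mul, mul_comm]
  simp

lemma actT_one (a : Ten n K ι) : actT (fun i j => if i = j then 1 else 0) a = a := by
  funext φ
  rw [actT, Finset.sum_eq_single φ]
  · simp
  · intro ψ _ h
    obtain ⟨s, hs⟩ := Function.ne_iff.1 h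
    rw [Finset.prod_eq_zero (Finset.mem_univ s) (if_neg fun h => hs h.symm), zero_mul]
  · simp

variable (A : TF n K K)

lemma TF.fixIdeal_le_oneIdeal : A.fixIdeal ≤ oneIdeal n K := by
  rw [oneIdeal_eq_ker]
  refine Ideal.span_le.2 ?_
  rintro _ ⟨ι, _, _, a, φ, -, rfl⟩
  have := aeval_pol (fun i j => if i = j then 1 else 0) a φ
  rw [actT_one] at this
  change evOne n K (pol a φ - C (a φ)) = 0
  rw [map_sub, evOne_C, sub_eq_zero]
  exact this

/-- The differentials at the identity of the functions in the fixing ideal. -/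
def TF.conormal : Submodule K (Fin n × Fin n → K) := (A.fixIdeal.restrictScalars K).map dOne

lemma TF.exists_euler : ∃ Y : Fin n × Fin n → Fin n × Fin n → K,
    (∀ r, ∀ q ∈ A.fixIdeal, ∑ p, dOne q p * Y r p = 0) ∧
    ∀ u ∈ oneIdeal n K, (∑ r, dX K r * lieD (Y r) u) - u ∈ oneIdeal n K ^ 2 ⊔ A.fixIdeal := by
  obtain ⟨B, hB, hW⟩ := exists_projection_matrix A.conormal
  refine ⟨fun r p => (if p = r then 1 else 0) - B p r, ?_, ?_⟩
  · intro r q hq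
    simp only [mul_sub, Finset.sum_sub_distrib]
    rw [hW (dOne q) ⟨q, hq, rfl⟩ r]
    simp
  intro u hu
  refine Submodule.span_induction (p := fun u _ => (∑ r, dX K r *
    lieD (fun p => (if p = r then 1 else 0) - B p r) u) - u ∈ oneIdeal n K ^ 2 ⊔ A.fixIdeal)
    ?_ (by simp) ?_ ?_ hu
  · rintro _ ⟨p, rfl⟩
    obtain ⟨q, hq, hqB⟩ := hB p
    have h1 : ∑ r, C (B p r) * dX K r ∈ oneIdeal n K ^ 2 ⊔ A.fixIdeal := by
      have h2 := taylor_mem (A.fixIdeal_le_oneIdeal hq)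
      rw [hqB] at h2
      have h3 := Ideal.sub_mem _ (Ideal.mem_sup_right (S := oneIdeal n K ^ 2) hq)
        (Ideal.mem_sup_left (T := A.fixIdeal) h2)
      rwa [sub_sub_cancel] at h3
    have h2 : ∀ r, dX K r * lieD (fun p => (if p = r then 1 else 0) - B p r) (dX K p) -
        dX K r * C ((if p = r then 1 else 0) - B p r) ∈ oneIdeal n K ^ 2 := by
      intro r
      rw [← mul_sub, pow_two]
      refine Ideal.mul_mem_mul (dX_mem r) ?_
      have h3 := sub_evOne_mem (lieD (fun p => (if p = r then 1 else 0) - B p r) (dX K p))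
      have h4 : evOne n K (lieD (fun p => (if p = r then 1 else 0) - B p r) (dX K p)) =
          (if p = r then 1 else 0) - B p r := by
        rw [dX, map_sub, ← algebraMap_eq, Derivation.map_algebraMap, sub_zero, lieD_X, map_sum]
        simp only [map_mul, evOne_X, evOne_C]
        simp
      rwa [h4] at h3
    have h3 := Ideal.sub_mem _ (Ideal.mem_sup_left (T := A.fixIdeal)
      (Ideal.sum_mem _ fun r (_ : r ∈ Finset.univ) => h2 r)) h1
    convert h3 using 1
    simp only [Finset.sum_sub_distrib, map_sub, mul_sub, mul_comm (dX K _) (C (B _ _))]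
    have h4 : ∑ r, dX K r * C (if p = r then (1 : K) else 0) = dX K p := by
      rw [Finset.sum_eq_single p]
      · simp
      · intro b _ hb
        simp [hb.symm]
      · simp
    rw [h4]
    ring
  · intro x y _ _ hx hy
    convert Ideal.add_mem _ hx hy using 1
    simp only [map_add, mul_add, Finset.sum_add_distrib]
    ring
  · intro r x hx hx'
    have h1 : (∑ s, dX K s * lieD (fun p => (if p = s then 1 else 0) - B p s) r) * x ∈
        oneIdeal n K ^ 2 := by
      rw [pow_two]
      exact Ideal.mul_mem_mul (Ideal.sum_mem _ fun s _ => Ideal.mul_mem_right _ _ (dX_mem s)) hx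
    convert Ideal.add_mem _ (Ideal.mul_mem_left _ r hx') (Ideal.mem_sup_left h1) using 1
    simp only [smul_eq_mul, Derivation.leibniz, mul_add, Finset.sum_add_distrib, mul_sub,
      Finset.mul_sum, Finset.sum_mul]
    rw [add_sub_right_comm]
    congr 1
    · congr 1
      exact Finset.sum_congr rfl fun _ _ => by ring
    · exact Finset.sum_congr rfl fun _ _ => by ring

lemma TF.radical_le_pow_sup [CharZero K] (j : ℕ) :
    A.fixIdeal.radical ≤ oneIdeal n K ^ (j + 1) ⊔ A.fixIdeal := by
  obtain ⟨Y, hY, hE⟩ := A.exists_euler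
  have hEm : ∀ i, ∀ q ∈ oneIdeal n K ^ i, (∑ r, dX K r * lieD (Y r) q) - i • q ∈
      oneIdeal n K ^ (i + 1) ⊔ A.fixIdeal := by
    intro i
    induction i with
    | zero =>
      intro q _
      rw [zero_smul, sub_zero, zero_add, pow_one]
      exact Ideal.mem_sup_left (Ideal.sum_mem _ fun s _ => Ideal.mul_mem_right _ _ (dX_mem s))
    | succ i ih =>
      intro q hq
      rw [pow_succ] at hq
      have hmul : ∀ (s t : ℕ) (x y : Mat n K), x ∈ oneIdeal n K ^ s →
          y ∈ oneIdeal n K ^ t ⊔ A.fixIdeal → x * y ∈ oneIdeal n K ^ (s + t) ⊔ A.fixIdeal := by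
        intro s t x y hx hy
        obtain ⟨y1, h1, y2, h2, rfl⟩ := Submodule.mem_sup.1 hy
        rw [mul_add, pow_add]
        exact Ideal.add_mem _ (Ideal.mem_sup_left (Ideal.mul_mem_mul hx h1))
          (Ideal.mem_sup_right (Ideal.mul_mem_left _ _ h2))
      refine Submodule.mul_induction_on hq ?_ ?_
      · intro a ha u hu
        have h1 := hmul i 2 a _ ha (hE u hu)
        have h2 := hmul 1 (i + 1) u _ (by rwa [pow_one]) (ih a ha)
        rw [add_comm 1] at h2
        convert Ideal.add_mem _ h1 h2 using 1
        simp only [Derivation.leibniz, mul_sub, mul_add, Finset.sum_add_distrib, Finset.mul_sum,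
          smul_eq_mul, nsmul_eq_mul]
        have h3 : ∀ x y : Mat n K, ∑ r, dX K r * (x * lieD (Y r) y) =
            ∑ r, x * (dX K r * lieD (Y r) y) := fun x y =>
          Finset.sum_congr rfl fun _ _ => by ring
        rw [h3, h3]
        push_cast
        ring
      · intro x y hx hy
        convert Ideal.add_mem _ hx hy using 1
        simp only [map_add, mul_add, Finset.sum_add_distrib, smul_add]
        ring
  have hJ : ∀ q ∈ A.fixIdeal, (∑ r, dX K r * lieD (Y r) q) ∈ A.fixIdeal := fun q hq =>
    Ideal.sum_mem _ fun r _ => Ideal.mul_mem_left _ _ (A.lieD_mem_fixIdeal (hY r) hq)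
  induction j with
  | zero =>
    intro q ⟨r, hr⟩
    have h1 := A.fixIdeal_le_oneIdeal hr
    rw [zero_add, pow_one]
    refine Ideal.mem_sup_left ?_
    rw [oneIdeal_eq_ker, RingHom.mem_ker] at h1 ⊢
    rw [map_pow] at h1
    exact eq_zero_of_pow_eq_zero h1
  | succ j ih =>
    intro q hq
    obtain ⟨a, ha, b, hb, rfl⟩ := Submodule.mem_sup.1 (ih hq)
    have h1 := hEm _ a ha
    have h2 : (∑ r, dX K r * lieD (Y r) (a + b)) ∈ oneIdeal n K ^ (j + 1 + 1) ⊔ A.fixIdeal := by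
      refine Ideal.sum_mem _ fun r _ => ?_
      have h3 := ih (derivation_mem_radical (lieD (Y r))
        (fun q hq => A.lieD_mem_fixIdeal (hY r) hq) hq)
      obtain ⟨c, hc, d, hd, h4⟩ := Submodule.mem_sup.1 h3
      rw [← h4, mul_add, pow_succ']
      exact Ideal.add_mem _ (Ideal.mem_sup_left (Ideal.mul_mem_mul (dX_mem r) hc))
        (Ideal.mem_sup_right (Ideal.mul_mem_left _ _ hd))
    have h3 : ((j + 1 : ℕ) : Mat n K) * a ∈ oneIdeal n K ^ (j + 1 + 1) ⊔ A.fixIdeal := by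
      convert Ideal.sub_mem _ (Ideal.sub_mem _ h2 (Ideal.mem_sup_right (hJ b hb))) h1 using 1
      simp only [map_add, mul_add, Finset.sum_add_distrib, nsmul_eq_mul]
      ring
    have h4 : ((j + 1 : ℕ) : K) ≠ 0 := Nat.cast_ne_zero.2 (Nat.succ_ne_zero j)
    have h5 := Ideal.mul_mem_left _ (algebraMap K (Mat n K) ((j + 1 : ℕ) : K)⁻¹) h3
    rw [← mul_assoc, ← map_natCast (algebraMap K (Mat n K)), ← map_mul, inv_mul_cancel₀ h4,
      map_one, one_mul] at h5
    exact Ideal.add_mem _ h5 (Ideal.mem_sup_right hb)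

lemma TF.exists_mul_mem_fixIdeal [CharZero K] {p : Mat n K} (hp : p ∈ A.fixIdeal.radical) :
    ∃ t, evOne n K t = 1 ∧ t * p ∈ A.fixIdeal := by
  have h : (Submodule.Quotient.mk p : Mat n K ⧸ A.fixIdeal) ∈
      (⨅ i : ℕ, oneIdeal n K ^ i • ⊤ : Submodule (Mat n K) (Mat n K ⧸ A.fixIdeal)) := by
    rw [Submodule.mem_iInf]
    intro i
    obtain ⟨a, ha, b, hb, hab⟩ := Submodule.mem_sup.1 (A.radical_le_pow_sup i hp)
    have h1 : (Submodule.Quotient.mk p : Mat n K ⧸ A.fixIdeal) = a • Submodule.Quotient.mk 1 := by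
      rw [← Submodule.Quotient.mk_smul, smul_eq_mul, mul_one, Submodule.Quotient.eq, ← hab,
        add_sub_cancel_left]
      exact hb
    rw [h1]
    exact Submodule.smul_mem_smul (Ideal.pow_le_pow_right (Nat.le_succ i) ha) Submodule.mem_top
  obtain ⟨s, hs⟩ := (Ideal.mem_iInf_smul_pow_eq_bot_iff (oneIdeal n K) _).1 h
  refine ⟨1 - s, ?_, ?_⟩
  · have : evOne n K s = 0 := by
      have h1 := oneIdeal_eq_ker.le s.2
      exact h1
    rw [map_sub, this, map_one, sub_zero]
  · have h1 : (Submodule.Quotient.mk (s.1 • p) : Mat n K ⧸ A.fixIdeal) =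
        Submodule.Quotient.mk p := by
      rw [Submodule.Quotient.mk_smul]
      exact hs
    rw [Submodule.Quotient.eq] at h1
    have h2 := A.fixIdeal.neg_mem h1
    convert h2 using 1
    rw [smul_eq_mul]
    ring

end Cartier

noncomputable section Invariants

set_option linter.unusedSectionVars false

variable {n : ℕ} {K : Type} [Field K]
variable {ι κ : Type} [Fintype ι] [Fintype κ] [DecidableEq ι] [DecidableEq κ]

/-- Substitution of `g * X` for the generic matrix `X`. -/
def translate (g : Fin n → Fin n → K) : Mat n K →ₐ[K] Mat n K :=
  aeval fun p => ∑ c, C (g p.1 c) * X (c, p.2)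

lemma translate_pol (g : Fin n → Fin n → K) (a : Ten n K ι) (φ : ι → Fin n) :
    translate g (pol a φ) = ∑ χ, C (∏ s, g (φ s) (χ s)) * pol a χ := by
  simp only [pol_apply, map_sum, Finset.mul_sum]
  rw [Finset.sum_comm]
  refine Finset.sum_congr rfl fun ψ _ => ?_
  rw [map_smul, mon, map_prod]
  simp only [translate, aeval_X]
  rw [Finset.prod_univ_sum, Fintype.piFinset_univ, Finset.smul_sum]
  refine Finset.sum_congr rfl fun χ _ => ?_
  rw [Finset.prod_mul_distrib, map_prod, mul_smul_comm, mon]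

lemma aeval_translate (g h : Fin n → Fin n → K) (p : Mat n K) :
    aeval (fun p : Fin n × Fin n => h p.1 p.2) (translate g p) =
      aeval (fun p : Fin n × Fin n => ∑ c, g p.1 c * h c p.2) p := by
  have : (aeval (R := K) (fun p : Fin n × Fin n => h p.1 p.2)).comp (translate g) =
      aeval (fun p : Fin n × Fin n => ∑ c, g p.1 c * h c p.2) := by
    refine MvPolynomial.algHom_ext fun q => ?_
    simp [translate]
  exact AlgHom.congr_fun this p

lemma actT_actT (g h : Fin n → Fin n → K) (a : Ten n K ι) :
    actT g (actT h a) = actT (fun i j => ∑ c, g i c * h c j) a := by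
  funext φ
  rw [← aeval_pol (fun i j => ∑ c, g i c * h c j), ← aeval_translate, translate_pol, map_sum, actT]
  refine Finset.sum_congr rfl fun χ _ => ?_
  rw [map_mul, aeval_pol, ← algebraMap_eq, AlgHom.commutes]
  rfl

lemma translate_translate {g h : Fin n → Fin n → K}
    (hgh : ∀ i j, ∑ c, g i c * h c j = if i = j then 1 else 0) (p : Mat n K) :
    translate h (translate g p) = p := by
  have : (translate h).comp (translate g) = AlgHom.id K _ := by
    refine MvPolynomial.algHom_ext fun q => ?_
    simp only [translate, AlgHom.comp_apply, aeval_X, map_sum, map_mul, AlgHom.id_apply,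
      ← algebraMap_eq, AlgHom.commutes, Finset.mul_sum, ← mul_assoc]
    rw [Finset.sum_comm]
    simp only [← Finset.sum_mul, ← map_mul, ← map_sum, hgh]
    rw [Finset.sum_eq_single q.1]
    · simp
    · intro b _ hb
      rw [if_neg hb.symm, map_zero, zero_mul]
    · simp
  exact AlgHom.congr_fun this p

variable (A : TF n K K)

/-- The matrices fixing all tensors of a tensor family. -/
def TF.Fixes (g : Fin n → Fin n → K) : Prop :=
  ∀ (ι : Type) [Fintype ι] [DecidableEq ι], ∀ a ∈ A.sp ι, actT g a = a

lemma TF.fixes_iff (g : Fin n → Fin n → K) :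
    A.Fixes g ↔ ∀ p ∈ A.fixIdeal, aeval (fun p : Fin n × Fin n => g p.1 p.2) p = 0 := by
  constructor
  · intro hg p hp
    have : A.fixIdeal ≤ RingHom.ker (aeval (R := K) fun p : Fin n × Fin n => g p.1 p.2) := by
      refine Ideal.span_le.2 ?_
      rintro _ ⟨ι, _, _, a, φ, ha, rfl⟩
      change aeval _ _ = _
      rw [map_sub, aeval_pol, hg ι a ha, ← algebraMap_eq, AlgHom.commutes]
      exact sub_self _
    exact this hp
  · intro h ι _ _ a ha
    funext φ
    have := h _ (A.pol_sub_mem_fixIdeal ha φ)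
    rwa [map_sub, aeval_pol, ← algebraMap_eq, AlgHom.commutes, sub_eq_zero] at this

variable {A}

lemma TF.Fixes.row {g : Fin n → Fin n → K} (hg : A.Fixes g) (i j : Fin n) :
    ∑ c, g i c * g j c = if i = j then 1 else 0 := by
  have := (A.fixes_iff g).1 hg _ (A.orthogonal_mem_fixIdeal i j)
  rw [map_sub, ← algebraMap_eq, AlgHom.commutes, sub_eq_zero, map_sum] at this
  simpa using this

lemma TF.Fixes.transpose {g : Fin n → Fin n → K} (hg : A.Fixes g) :
    A.Fixes fun i j => g j i := by
  intro ι _ _ a ha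
  conv_lhs => rw [← hg ι a ha, actT_actT]
  simp only [orthogonal_col hg.row]
  exact actT_one a

lemma TF.Fixes.translate_mem {g : Fin n → Fin n → K} (hg : A.Fixes g) {p : Mat n K}
    (hp : p ∈ A.fixIdeal) : translate g p ∈ A.fixIdeal := by
  have : A.fixIdeal ≤ A.fixIdeal.comap (translate g) := by
    refine Ideal.span_le.2 ?_
    rintro _ ⟨ι, _, _, a, φ, ha, rfl⟩
    change translate g _ ∈ A.fixIdeal
    have h : translate g (pol a φ - C (a φ)) =
        ∑ χ, C (∏ s, g (φ s) (χ s)) * (pol a χ - C (a χ)) := by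
      rw [map_sub, translate_pol]
      simp only [mul_sub, Finset.sum_sub_distrib]
      congr 1
      rw [← algebraMap_eq, AlgHom.commutes]
      conv_lhs => rw [← hg ι a ha]
      simp [actT, algebraMap_eq]
    rw [h]
    exact Ideal.sum_mem _ fun χ _ => Ideal.mul_mem_left _ _ (A.pol_sub_mem_fixIdeal ha χ)
  exact this hp

variable (A)

lemma TF.fixIdeal_isRadical [CharZero K] [IsAlgClosed K] : A.fixIdeal.radical ≤ A.fixIdeal := by
  intro p hp
  set I : Ideal (Mat n K) := A.fixIdeal.colon {p} with hI
  have hmem : ∀ t, t ∈ I ↔ t * p ∈ A.fixIdeal := fun t => by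
    rw [hI, Submodule.mem_colon_singleton, smul_eq_mul]
  have hempty : zeroLocus K I = ∅ := by
    refine Set.eq_empty_iff_forall_notMem.2 fun x hx => ?_
    set g : Fin n → Fin n → K := fun i j => x (i, j) with hg
    have hx' : ∀ t ∈ I, aeval (fun p : Fin n × Fin n => g p.1 p.2) t = 0 := fun t ht => hx t ht
    have hgA : A.Fixes g := (A.fixes_iff g).2 fun q hq =>
      hx' q ((hmem q).2 (Ideal.mul_mem_right _ _ hq))
    have h1 : translate g p ∈ A.fixIdeal.radical := by
      obtain ⟨N, hN⟩ := hp
      exact ⟨N, by rw [← map_pow]; exact hgA.translate_mem hN⟩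
    obtain ⟨t, ht, htp⟩ := A.exists_mul_mem_fixIdeal h1
    have h2 := hgA.transpose.translate_mem htp
    rw [map_mul, translate_translate hgA.row] at h2
    have h3 := hx' _ ((hmem _).2 h2)
    rw [aeval_translate] at h3
    simp only [orthogonal_col hgA.row] at h3
    exact one_ne_zero (ht.symm.trans h3)
  have h1 : I.radical = ⊤ := by
    rw [← vanishingIdeal_zeroLocus_eq_radical (K := K), hempty, vanishingIdeal_empty]
  have h2 := (hmem 1).1 ((Ideal.eq_top_iff_one _).1 (Ideal.radical_eq_top.1 h1))
  rwa [one_mul] at h2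

variable {A}

lemma TF.Nondeg.mem_of_fixed [CharZero K] [IsAlgClosed K] (hA : A.Nondeg) {b : Ten n K ι}
    (hb : ∀ g, A.Fixes g → actT g b = b) : b ∈ A.sp ι := by
  have h : hA.proj b = b := by
    funext φ
    have h1 : pol b φ - C (b φ) ∈ A.fixIdeal.radical := by
      rw [← vanishingIdeal_zeroLocus_eq_radical (K := K)]
      intro x hx
      have h2 := hb (fun i j => x (i, j)) ((A.fixes_iff _).2 fun q hq => hx q hq)
      have h3 := aeval_pol (fun i j => x (i, j)) b φ
      rw [h2] at h3
      rw [map_sub, ← algebraMap_eq, AlgHom.commutes]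
      exact sub_eq_zero.2 h3
    have h2 := hA.haar_fixIdeal (A.fixIdeal_isRadical h1)
    rw [map_sub, hA.haar_pol, C_eq_smul_one, map_smul, hA.haar_one, smul_eq_mul, mul_one,
      sub_eq_zero] at h2
    exact h2
  rw [← h]
  exact hA.proj_mem b

lemma fixes_spanTF_iff (L : VertexModel K n) (g : Fin n → Fin n → K) :
    (spanTF K (valM L) Set.univ : TF n K K).Fixes g ↔ Matrix.of g ∈ Stab L := by
  constructor
  · intro hg
    refine ⟨?_, valM_injective ?_⟩
    · change (Matrix.of g).transpose * Matrix.of g = 1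
      ext i j
      rw [Matrix.mul_apply, Matrix.one_apply, ← orthogonal_col hg.row]
      rfl
    · funext d
      obtain ⟨φ, hφ⟩ := exists_coloring d
      have h := (actsTo_valM g L _ φ).trans
        (congrFun (hg _ _ (Submodule.subset_span (Gen_basic (valM L) (Set.mem_univ _)))) φ)
      rw [hφ] at h
      exact h
  · rintro ⟨h1, h2⟩ ι _ _ a ha
    have hcol : ∀ i j, ∑ c, g c i * g c j = if i = j then 1 else 0 := fun i j => by
      have := congrFun (congrFun h1 i) j
      rwa [Matrix.mul_apply, Matrix.one_apply] at this
    have hrow := orthogonal_col (g := fun i j => g j i) hcol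
    have hm : ActsTo g (valM L) (valM L) := by
      have := actsTo_valM g L
      rwa [show L ∘ₗ (aeval fun i => ∑ j, C (g i j) * X j).toLinearMap = L from h2] at this
    refine Submodule.span_induction (p := fun a _ => actT g a = a) ?_ ?_ ?_ ?_ ha
    · rintro _ ⟨V, H, E, _, _, _, _, _, p, q, hq, -, rfl⟩
      exact (diagram_actsTo p q hq hrow hcol hm).symm
    · funext φ
      simp [actT]
    · intro x y _ _ hx hy
      have := actT_smul_add g (1 : K) x y
      rwa [one_smul, one_smul, hx, hy] at this
    · intro c x _ hx
      have := actT_smul_add g c x 0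
      rw [hx, add_zero] at this
      rw [this]
      funext φ
      simp [actT]

lemma sp_eq_invSub [CharZero K] [IsAlgClosed K] (L : VertexModel K n)
    (hL : (spanTF K (valM L) Set.univ : TF n K K).Nondeg) (k : ℕ) :
    (spanTF K (valM L) Set.univ : TF n K K).sp (Fin k) = invSub (Stab L) k := by
  ext b
  constructor
  · intro hb g hg
    exact (fixes_spanTF_iff L g).2 hg _ b hb
  · intro hb
    refine hL.mem_of_fixed fun g hg => ?_
    exact hb _ ((fixes_spanTF_iff L g).1 hg)

end Invariants

noncomputable section Fragments

set_option linter.unusedSectionVars false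

variable {n k : ℕ} {K : Type} [Field K]

lemma prod_map_X_colorsAt {V H : Type} [Fintype H] [DecidableEq V] (p : H → V) (c : H → Fin n)
    (v : V) : (((colorsAt p c v).map X).prod : MvPolynomial (Fin n) K) =
      ∏ x, if p x = v then X (c x) else 1 := by
  rw [colorsAt]
  induction (Finset.univ : Finset H) using Finset.cons_induction with
  | empty => simp
  | cons x s hx ih =>
    rw [Finset.sum_cons, Finset.prod_cons, Multiset.map_add, Multiset.prod_add, ih]
    congr 1
    split_ifs <;> simp

lemma ph_eq_diagram (h : VertexModel K n) (F : Fragment k) {V H E : Type} [Fintype V] [Fintype H]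
    [Fintype E] [DecidableEq V] [DecidableEq E] (eV : V ≃ Fin F.nv) (eE : E ≃ Fin F.ne)
    (p : H → V) (q : H ⊕ Fin k → E)
    (h1 : ∀ e v, (F.inc (eE e)).count (Sum.inl (eV v)) =
      ∑ x, if q (Sum.inl x) = e ∧ p x = v then 1 else 0)
    (h2 : ∀ e j, Sum.inr j ∈ F.inc (eE e) ↔ q (Sum.inr j) = e) :
    ph h F = diagram (valM h) p q := by
  funext φ
  rw [ph, hphi, diagram, Finset.sum_filter, ← (Equiv.arrowCongr eE (Equiv.refl (Fin n))).sum_comp]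
  refine Finset.sum_congr rfl fun ψ _ => ?_
  have hc : (∀ e j, Sum.inr j ∈ F.inc e →
      Equiv.arrowCongr eE (Equiv.refl (Fin n)) ψ e = φ j) ↔ ∀ j, ψ (q (Sum.inr j)) = φ j := by
    rw [eE.symm.forall_congr_left]
    simp only [Equiv.symm_symm, h2]
    constructor
    · intro h j
      have := h _ j rfl
      simpa using this
    · rintro h e j rfl
      simpa using h j
  split_ifs with h3 h4 h4
  · rw [← eV.prod_comp]
    refine Finset.prod_congr rfl fun v _ => ?_
    rw [valM, prod_map_X_colorsAt, monomialAt, ← eE.prod_comp]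
    congr 1
    simp only [h1]
    simp only [← Finset.prod_pow_eq_pow_sum]
    rw [Finset.prod_comm]
    refine Finset.prod_congr rfl fun x _ => ?_
    rw [Finset.prod_eq_single (q (Sum.inl x))]
    · by_cases hx : p x = v <;> simp [hx]
    · intro e _ he
      rw [if_neg fun h => he h.1.symm, pow_zero]
    · simp
  · exact absurd (hc.1 h3) h4
  · exact absurd (hc.2 h4) h3
  · rfl

lemma Fragment.exists_openEdge (F : Fragment k) : ∃ o : Fin k → Fin F.ne,
    ∀ e j, (F.inc e).count (Sum.inr j) = if o j = e then 1 else 0 := by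
  have h : ∀ j, ∃ o, ∀ e, (F.inc e).count (Sum.inr j) = if o = e then 1 else 0 := by
    intro j
    have h1 := F.openEnd j
    obtain ⟨o, -, ho⟩ := Finset.exists_ne_zero_of_sum_ne_zero (h1.trans_ne one_ne_zero)
    have h2 := Finset.add_sum_erase Finset.univ (fun e => (F.inc e).count (Sum.inr j))
      (Finset.mem_univ o)
    rw [h1] at h2
    have h3 : ∑ e ∈ Finset.univ.erase o, (F.inc e).count (Sum.inr j) = 0 := by omega
    refine ⟨o, fun e => ?_⟩
    split_ifs with he
    · subst he
      omega
    · exact Finset.sum_eq_zero_iff.1 h3 e (Finset.mem_erase.2 ⟨fun h => he h.symm,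
        Finset.mem_univ _⟩)
  choose o ho using h
  exact ⟨o, fun e j => ho j e⟩

lemma Fragment.mem_inc_iff {F : Fragment k} {o : Fin k → Fin F.ne}
    (ho : ∀ e j, (F.inc e).count (Sum.inr j) = if o j = e then 1 else 0) (e : Fin F.ne)
    (j : Fin k) : Sum.inr j ∈ F.inc e ↔ o j = e := by
  rw [← Multiset.count_pos, ho]
  split_ifs with h <;> simp [h]

lemma Fragment.exists_diagram (F : Fragment k) : ∃ (H : Type) (_ : Fintype H) (p : H → Fin F.nv)
    (q : H ⊕ Fin k → Fin F.ne), Paired q ∧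
      ∀ h : VertexModel K n, ph h F = diagram (valM h) p q := by
  obtain ⟨o, ho⟩ := F.exists_openEdge
  have hH : ∀ e v, (∑ x : Σ e v, Fin ((F.inc e).count (Sum.inl v)),
      if x.1 = e ∧ x.2.1 = v then 1 else 0) = (F.inc e).count (Sum.inl v) := by
    intro e v
    rw [Fintype.sum_sigma, Finset.sum_eq_single e]
    · rw [Fintype.sum_sigma, Finset.sum_eq_single v]
      · simp
      · intro w _ hw
        simp [hw]
      · simp
    · intro e' _ he
      simp [he]
    · simp
  refine ⟨Σ e v, Fin ((F.inc e).count (Sum.inl v)), inferInstance, fun x => x.2.1,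
    Sum.elim (fun x => x.1) o, ?_, fun h => ?_⟩
  · intro e
    have : (∑ x, if Sum.elim (fun x : Σ e v, Fin ((F.inc e).count (Sum.inl v)) => x.1) o x = e
        then 1 else 0) = Multiset.card (F.inc e) := by
      rw [← Multiset.sum_count_eq_card (s := Finset.univ) (fun a _ => Finset.mem_univ a),
        Fintype.sum_sum_type, Fintype.sum_sum_type]
      simp only [Sum.elim_inl, Sum.elim_inr, ho]
      congr 1
      simp only [← hH]
      rw [Finset.sum_comm]
      refine Finset.sum_congr rfl fun x _ => ?_
      by_cases hx : x.1 = e <;> simp [hx]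
    rw [this]
    exact F.card_inc e
  · refine ph_eq_diagram h F (Equiv.refl _) (Equiv.refl _) _ _ (fun e v => (hH e v).symm) ?_
    exact F.mem_inc_iff ho

lemma exists_fragment {V H E : Type} [Fintype V] [Fintype H] [Fintype E] [DecidableEq V]
    [DecidableEq E] (p : H → V) (q : H ⊕ Fin k → E) (hq : Paired q) :
    ∃ F : Fragment k, ∀ h : VertexModel K n, ph h F = diagram (valM h) p q := by
  let eV := Fintype.equivFin V
  let eE := Fintype.equivFin E
  let inc (e : Fin (Fintype.card E)) : Multiset (Fin (Fintype.card V) ⊕ Fin k) :=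
    ({x | q x = eE.symm e} : Finset (H ⊕ Fin k)).val.map (Sum.map (fun x => eV (p x)) id)
  have hcount : ∀ e y, (inc e).count y = ∑ x, if q x = eE.symm e ∧
      y = Sum.map (fun x => eV (p x)) id x then 1 else 0 := by
    intro e y
    rw [Multiset.count_map, ← Finset.filter_val, Finset.filter_filter, ← Finset.card_def,
      Finset.card_filter]
  have hr : ∀ e j, (inc e).count (Sum.inr j) = if q (Sum.inr j) = eE.symm e then 1 else 0 := by
    intro e j
    rw [hcount, Fintype.sum_sum_type]
    simp only [Sum.map_inl, reduceCtorEq, and_false, if_false, Finset.sum_const_zero, zero_add,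
      Sum.map_inr, Sum.inr.injEq, id]
    rw [Finset.sum_eq_single j]
    · simp
    · intro i _ hi
      rw [if_neg fun h => hi h.2.symm]
    · simp
  let F : Fragment k :=
    { nv := Fintype.card V
      ne := Fintype.card E
      inc := inc
      card_inc := fun e => by
        rw [Multiset.card_map, Finset.card_val, Finset.card_filter]
        exact hq _
      openEnd := fun j => by
        simp only [hr]
        rw [eE.symm.sum_comp fun e => if q (Sum.inr j) = e then 1 else 0]
        simp }
  refine ⟨F, fun h => ph_eq_diagram h F eV eE p q (fun e v => ?_) fun e j => ?_⟩
  · change (inc (eE e)).count _ = _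
    rw [hcount, Fintype.sum_sum_type]
    simp [eq_comm]
  · change _ ∈ inc (eE e) ↔ _
    rw [← Multiset.count_pos, hr, Equiv.symm_apply_apply]
    split_ifs with h <;> simp [h]

lemma span_range_ph (h : VertexModel K n) :
    Submodule.span K (Set.range (ph h : Fragment k → Tensor K n k)) =
      (spanTF K (valM h) Set.univ : TF n K K).sp (Fin k) := by
  change _ = Submodule.span K (Gen (valM h) Set.univ (Fin k))
  congr 1
  ext x
  constructor
  · rintro ⟨F, rfl⟩
    obtain ⟨H, _, p, q, hq, hF⟩ := F.exists_diagram (n := n) (K := K)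
    exact ⟨Fin F.nv, H, Fin F.ne, inferInstance, inferInstance, inferInstance, inferInstance,
      inferInstance, p, q, hq, fun _ => Set.mem_univ _, hF h⟩
  · rintro ⟨V, H, E, _, _, _, _, _, p, q, hq, -, rfl⟩
    obtain ⟨F, hF⟩ := exists_fragment (n := n) (K := K) p q hq
    exact ⟨F, hF h⟩

lemma partitionFun_eq_ph (h : VertexModel K n) (G : Graph) (φ : Fin 0 → Fin n) :
    partitionFun h G = ph h G φ := by
  rw [ph, hphi, Finset.filter_true_of_mem fun _ _ _ j => j.elim0]
  rfl

end Fragments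

noncomputable section Glueing

set_option linter.unusedSectionVars false

variable {n k : ℕ} {K : Type} [Field K]

lemma card_filterMap_inl {α β : Type} [DecidableEq α] (f : α ⊕ Fin k → Option β)
    (hl : ∀ a, (f (Sum.inl a)).isSome) (hr : ∀ j, f (Sum.inr j) = none)
    (s : Multiset (α ⊕ Fin k)) :
    Multiset.card (s.filterMap f) + ∑ j, s.count (Sum.inr j) = Multiset.card s := by
  induction s using Multiset.induction with
  | empty => simp
  | cons a s ih =>
    simp only [Multiset.count_cons, Finset.sum_add_distrib, Multiset.card_cons, ← ih]
    cases a with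
    | inl a =>
      obtain ⟨b, hb⟩ := Option.isSome_iff_exists.1 (hl a)
      rw [Multiset.filterMap_cons_some _ _ _ hb]
      simp
      ring
    | inr j =>
      rw [Multiset.filterMap_cons_none _ _ (hr j)]
      simp
      ring

section

variable (F H : Fragment k) {o : Fin k → Fin F.ne} {o' : Fin k → Fin H.ne}

lemma touches_iff
    (ho : ∀ e j, (F.inc e).count (Sum.inr j) = if o j = e then 1 else 0)
    (ho' : ∀ e j, (H.inc e).count (Sum.inr j) = if o' j = e then 1 else 0)
    (j : Fin k) (a : Fin F.ne ⊕ Fin H.ne) :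
    touches F H j a ↔ a = Sum.inl (o j) ∨ a = Sum.inr (o' j) := by
  cases a with
  | inl e => simp [touches, F.mem_inc_iff ho, eq_comm]
  | inr e => simp [touches, H.mem_inc_iff ho', eq_comm]

lemma glueSetoid_pair
    (ho : ∀ e j, (F.inc e).count (Sum.inr j) = if o j = e then 1 else 0)
    (ho' : ∀ e j, (H.inc e).count (Sum.inr j) = if o' j = e then 1 else 0)
    (j : Fin k) : glueSetoid F H (Sum.inl (o j)) (Sum.inr (o' j)) :=
  Relation.EqvGen.rel _ _ ⟨j, (touches_iff F H ho ho' j _).2 (Or.inl rfl),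
    (touches_iff F H ho ho' j _).2 (Or.inr rfl)⟩

lemma glueSetoid_le
    (ho : ∀ e j, (F.inc e).count (Sum.inr j) = if o j = e then 1 else 0)
    (ho' : ∀ e j, (H.inc e).count (Sum.inr j) = if o' j = e then 1 else 0)
    (r : Setoid (Fin F.ne ⊕ Fin H.ne))
    (hr : ∀ j, r (Sum.inl (o j)) (Sum.inr (o' j))) : glueSetoid F H ≤ r := by
  refine Setoid.eqvGen_le ?_
  rintro a b ⟨j, ha, hb⟩
  rcases (touches_iff F H ho ho' j _).1 ha with rfl | rfl <;>
    rcases (touches_iff F H ho ho' j _).1 hb with rfl | rfl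
  · exact r.refl _
  · exact hr j
  · exact r.symm (hr j)
  · exact r.refl _

lemma card_intEnds
    (ho : ∀ e j, (F.inc e).count (Sum.inr j) = if o j = e then 1 else 0)
    (ho' : ∀ e j, (H.inc e).count (Sum.inr j) = if o' j = e then 1 else 0)
    (e : Fin F.ne ⊕ Fin H.ne) :
    Multiset.card (intEnds F H e) + (∑ j, if Sum.inl (o j) = e then 1 else 0) +
      (∑ j, if Sum.inr (o' j) = e then 1 else 0) =
      Sum.elim (fun e => Multiset.card (F.inc e)) (fun e => Multiset.card (H.inc e)) e := by
  cases e with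
  | inl e =>
    simp only [Sum.inl.injEq, reduceCtorEq, if_false, Finset.sum_const_zero, add_zero, Sum.elim_inl,
      ← ho]
    exact card_filterMap_inl _ (fun _ => rfl) (fun _ => rfl) _
  | inr e =>
    simp only [Sum.inr.injEq, reduceCtorEq, if_false, Finset.sum_const_zero, add_zero, Sum.elim_inr,
      ← ho']
    exact card_filterMap_inl _ (fun _ => rfl) (fun _ => rfl) _

lemma card_glueInc
    (ho : ∀ e j, (F.inc e).count (Sum.inr j) = if o j = e then 1 else 0)
    (ho' : ∀ e j, (H.inc e).count (Sum.inr j) = if o' j = e then 1 else 0)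
    (c : Fin (glueNE F H)) :
    Multiset.card (glueInc F H c) = 2 ∨ Multiset.card (glueInc F H c) = 0 := by
  classical
  obtain ⟨e₀, he₀⟩ := Quotient.exists_rep (glueEquiv F H c)
  have h := classSum_of_least (fun j => Sum.inl (o j)) (fun j => Sum.inr (o' j)) (glueSetoid F H)
    (glueSetoid_pair F H ho ho') (glueSetoid_le F H ho ho')
    (fun e => Multiset.card (intEnds F H e)) (fun e => by
      have h : ∀ m, m = Sum.elim (fun e => Multiset.card (F.inc e))
          (fun e => Multiset.card (H.inc e)) e → m = 2 ∨ m = 0 := by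
        rintro _ rfl
        cases e with
        | inl e => exact F.card_inc e
        | inr e => exact H.card_inc e
      refine h _ (Eq.trans ?_ (card_intEnds F H ho ho' e))
      congr!) e₀
  have h1 : Multiset.card (glueInc F H c) =
      ∑ e with glueSetoid F H e e₀, Multiset.card (intEnds F H e) := by
    rw [glueInc, Multiset.card_sum]
    refine Finset.sum_congr (Finset.filter_congr fun e _ => ?_) fun _ _ => rfl
    rw [← he₀]
    exact Quotient.eq
  rw [h1]
  exact h

end

lemma count_filterMap_inl {α β : Type} [DecidableEq α] [DecidableEq β] (f : α ⊕ Fin k → Option β)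
    (g : α → β) (hg : Function.Injective g) (hl : ∀ a, f (Sum.inl a) = some (g a))
    (hr : ∀ j, f (Sum.inr j) = none) (s : Multiset (α ⊕ Fin k)) (a : α) :
    (s.filterMap f).count (g a) = s.count (Sum.inl a) := by
  induction s using Multiset.induction with
  | empty => simp
  | cons b s ih =>
    cases b with
    | inl b =>
      rw [Multiset.filterMap_cons_some _ _ _ (hl b), Multiset.count_cons, Multiset.count_cons, ih]
      simp [hg.eq_iff]
    | inr j =>
      rw [Multiset.filterMap_cons_none _ _ (hr j), Multiset.count_cons, ih]
      simp

lemma count_intEnds_inl_castAdd (F H : Fragment k) (e : Fin F.ne) (v : Fin F.nv) :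
    (intEnds F H (Sum.inl e)).count (Sum.inl (Fin.castAdd H.nv v)) =
      (F.inc e).count (Sum.inl v) :=
  count_filterMap_inl _ (fun v => Sum.inl (Fin.castAdd H.nv v))
    (Sum.inl_injective.comp (Fin.castAdd_injective _ _)) (fun _ => rfl) (fun _ => rfl) _ v

lemma count_intEnds_inr_natAdd (F H : Fragment k) (e : Fin H.ne) (v : Fin H.nv) :
    (intEnds F H (Sum.inr e)).count (Sum.inl (Fin.natAdd F.nv v)) =
      (H.inc e).count (Sum.inl v) :=
  count_filterMap_inl _ (fun v => Sum.inl (Fin.natAdd F.nv v))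
    (Sum.inl_injective.comp (Fin.natAdd_injective _ _)) (fun _ => rfl) (fun _ => rfl) _ v

lemma count_intEnds_inl_natAdd (F H : Fragment k) (e : Fin F.ne) (v : Fin H.nv) :
    (intEnds F H (Sum.inl e)).count (Sum.inl (Fin.natAdd F.nv v)) = 0 := by
  rw [Multiset.count_eq_zero, intEnds, Multiset.mem_filterMap]
  rintro ⟨a | a, -, h⟩
  · have := congrArg Fin.val (Sum.inl.inj (Option.some.inj h))
    have h2 := a.2
    simp at this
    omega
  · simp at h

lemma count_intEnds_inr_castAdd (F H : Fragment k) (e : Fin H.ne) (v : Fin F.nv) :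
    (intEnds F H (Sum.inr e)).count (Sum.inl (Fin.castAdd H.nv v)) = 0 := by
  rw [Multiset.count_eq_zero, intEnds, Multiset.mem_filterMap]
  rintro ⟨a | a, -, h⟩
  · have := congrArg Fin.val (Sum.inl.inj (Option.some.inj h))
    have h2 := v.2
    simp at this
    omega
  · simp at h

lemma partitionFun_glue_eq (h : VertexModel K n) (F H : Fragment k) :
    partitionFun h (glue F H) = ∑ ψ : Fin (glueNE F H) → Fin n, ∏ v : Fin (F.nv + H.nv),
      h (∏ c, X (ψ c) ^ (glueInc F H c).count (Sum.inl v)) := by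
  obtain ⟨o, ho⟩ := F.exists_openEdge
  obtain ⟨o', ho'⟩ := H.exists_openEdge
  rw [glue, dif_pos (card_glueInc F H ho ho')]
  rfl

lemma hphi_eq (h : VertexModel K n) (F : Fragment k) {o : Fin k → Fin F.ne}
    (ho : ∀ e j, (F.inc e).count (Sum.inr j) = if o j = e then 1 else 0) (φ : Fin k → Fin n) :
    ph h F φ = ∑ ψ, if (fun j => ψ (o j)) = φ then ∏ v, h (monomialAt F ψ v) else 0 := by
  rw [ph, hphi, ← Finset.sum_filter]
  refine Finset.sum_congr (Finset.filter_congr fun ψ _ => ?_) fun _ _ => rfl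
  simp only [F.mem_inc_iff ho, _root_.funext_iff]
  exact ⟨fun h j => h _ j rfl, fun h e j he => he ▸ h j⟩

/-- The partition function of a glued graph is the pairing of the tensors of its parts. -/
lemma partitionFun_glue (h : VertexModel K n) (F H : Fragment k) :
    partitionFun h (glue F H) = ∑ φ, ph h F φ * ph h H φ := by
  classical
  obtain ⟨o, ho⟩ := F.exists_openEdge
  obtain ⟨o', ho'⟩ := H.exists_openEdge
  have _ : Fintype (Quotient (glueSetoid F H)) := Fintype.ofFinite _
  let Φ (χ : Fin F.ne ⊕ Fin H.ne → Fin n) : K := ∏ v : Fin (F.nv + H.nv),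
    h (∏ a, X (χ a) ^ (intEnds F H a).count (Sum.inl v))
  have h1 : partitionFun h (glue F H) =
      ∑ ψ : Quotient (glueSetoid F H) → Fin n, Φ fun e => ψ (Quotient.mk _ e) := by
    rw [partitionFun_glue_eq,
      ← ((glueEquiv F H).arrowCongr (Equiv.refl (Fin n))).symm.sum_comp]
    refine Finset.sum_congr rfl fun ψ _ => Finset.prod_congr rfl fun v _ => ?_
    congr 1
    have h3 : ∀ c, (glueInc F H c).count (Sum.inl v) =
        ∑ a with Quotient.mk (glueSetoid F H) a = glueEquiv F H c,
          (intEnds F H a).count (Sum.inl v) := fun c => by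
      rw [glueInc, Multiset.count_sum']
    simp only [h3, ← Finset.prod_pow_eq_pow_sum]
    refine ((glueEquiv F H).prod_comp fun c => ∏ a with Quotient.mk (glueSetoid F H) a = c,
      (X (ψ c) : MvPolynomial (Fin n) K) ^ (intEnds F H a).count (Sum.inl v)).trans ?_
    rw [← Finset.prod_fiberwise Finset.univ (Quotient.mk (glueSetoid F H))]
    refine Finset.prod_congr rfl fun c _ => Finset.prod_congr rfl fun a ha => ?_
    rw [(Finset.mem_filter.1 ha).2]
  have h2 : ∀ ψ₁ ψ₂, Φ (Sum.elim ψ₁ ψ₂) =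
      (∏ v, h (monomialAt F ψ₁ v)) * ∏ v, h (monomialAt H ψ₂ v) := by
    intro ψ₁ ψ₂
    simp only [Φ, Fin.prod_univ_add, Fintype.prod_sum_type, Sum.elim_inl, Sum.elim_inr,
      count_intEnds_inl_castAdd, count_intEnds_inr_castAdd, count_intEnds_inl_natAdd,
      count_intEnds_inr_natAdd, pow_zero, Finset.prod_const_one, mul_one, one_mul]
    rfl
  rw [h1, sum_quotient_coloring (fun j => Sum.inl (o j)) (fun j => Sum.inr (o' j))
    (glueSetoid F H) (glueSetoid_pair F H ho ho') (glueSetoid_le F H ho ho') Φ]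
  refine Eq.trans (Eq.trans ?_ (sum_elim_coloring fun χ : Fin F.ne ⊕ Fin H.ne → Fin n =>
    if ∀ j, χ (Sum.inl (o j)) = χ (Sum.inr (o' j)) then Φ χ else 0)) ?_
  · congr!
  simp only [hphi_eq h F ho, hphi_eq h H ho', Finset.sum_mul_sum, Sum.elim_inl, Sum.elim_inr, h2]
  conv_rhs => rw [Finset.sum_comm]
  refine Finset.sum_congr rfl fun ψ₁ _ => ?_
  conv_rhs => rw [Finset.sum_comm]
  refine Finset.sum_congr rfl fun ψ₂ _ => ?_
  rw [Finset.sum_eq_single fun j => ψ₁ (o j)]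
  · rw [if_pos rfl]
    by_cases hc : ∀ j, ψ₁ (o j) = ψ₂ (o' j)
    · rw [if_pos hc, if_pos (funext fun j => (hc j).symm)]
    · rw [if_neg hc, if_neg fun h => hc fun j => (congrFun h j).symm, mul_zero]
  · intro φ _ hφ
    rw [if_neg fun h => hφ h.symm, zero_mul]
  · simp

/-- For a nondegenerate vertex model the rows of the connection matrix span a copy of the
space of tensors of fragments. -/
lemma connectionRank_eq (h : VertexModel K n)
    (hA : (spanTF K (valM h) Set.univ : TF n K K).Nondeg) (k : ℕ) :
    connectionRank h k =
      Module.finrank K ((spanTF K (valM h) Set.univ : TF n K K).sp (Fin k)) := by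
  set A : TF n K K := spanTF K (valM h) Set.univ
  let T : Ten n K (Fin k) →ₗ[K] Fragment k → K :=
    LinearMap.pi fun H => (pairL K (ι := Fin k) (n := n)).flip (ph h H)
  have hT : Submodule.span K (Set.range fun F : Fragment k => fun H : Fragment k =>
      partitionFun h (glue F H)) = (A.sp (Fin k)).map T := by
    rw [← span_range_ph, Submodule.map_span, ← Set.range_comp]
    congr 2
    funext F H
    exact partitionFun_glue h F H
  have hinj : Function.Injective (T.domRestrict (A.sp (Fin k))) := by
    rw [injective_iff_map_eq_zero]
    rintro ⟨x, hx⟩ h0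
    refine Subtype.ext (hA _ x hx fun y hy => ?_)
    rw [← span_range_ph] at hy
    have : Submodule.span K (Set.range (ph h : Fragment k → Tensor K n k)) ≤
        LinearMap.ker (pairL K (ι := Fin k) (n := n) x) := by
      refine Submodule.span_le.2 ?_
      rintro _ ⟨H, rfl⟩
      exact congrFun h0 H
    exact this hy
  rw [connectionRank, hT, ← LinearMap.range_domRestrict, LinearMap.finrank_range_of_inj hinj]

end Glueing

end VertexModels

/-- **Theorem 1** (main theorem).  Over an algebraically closed field of
characteristic zero, for every vertex model `h` there is a vertex model `h'`
with the same partition function such that for every `k` the rank of the edge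
connection matrix `M_{f_h,k}` equals `dim (V^{⊗k})^{Stab(h')}`. -/
theorem rank_edge_connection_matrix (𝔽 : Type) [Field 𝔽] [IsAlgClosed 𝔽] [CharZero 𝔽]
    (n : ℕ) (h : VertexModel 𝔽 n) :
    ∃ h' : VertexModel 𝔽 n,
      (∀ G : Graph, partitionFun h G = partitionFun h' G) ∧
      ∀ k : ℕ, connectionRank h k = Module.finrank 𝔽 (invSub (Stab h') k) := by
  obtain ⟨m', hm', heq⟩ := exists_nondeg_model (valM h)
  obtain ⟨h', rfl⟩ := exists_valM m'
  have hpart : ∀ G : Graph, partitionFun h G = partitionFun h' G := by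
    intro G
    obtain ⟨H, _, p, q, hq, hG⟩ := G.exists_diagram (n := n) (K := 𝔽)
    rw [partitionFun_eq_ph h G Fin.elim0, partitionFun_eq_ph h' G Fin.elim0, hG, hG,
      heq _ _ _ _ p q hq]
  refine ⟨h', hpart, fun k => ?_⟩
  rw [← sp_eq_invSub h' hm' k, ← connectionRank_eq h' hm']
  have hrow : (fun F H : Fragment k => partitionFun h (glue F H)) =
      fun F H => partitionFun h' (glue F H) := funext fun F => funext fun H => hpart _
  rw [connectionRank, hrow]
  rfl
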